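/- arXiv:1003.2792 — 3 statements merged into one kernel-verified Lean document; each statement's English description precedes it below -/
import Mathlib

section
/- Let G = PSL₂(q) where q = p^e for a prime p and a positive integer e, and let A₁, A₂ ∈ G. Then Σ(A₁) ∩ Σ(A₂) = {1} if and only if either (a) the orders of A₁ and A₂ are relatively prime, or (b) p is odd, e is even, A₁ and A₂ both have order p, and A₁ is not conjugate to A₂ in G. -/
open Matrix

/-- The projective special linear group `PSL₂(F) = SL(2, F) / Z(SL(2, F))`. -/
abbrev PSL2 (F : Type*) [Field F] :=
  Matrix.SpecialLinearGroup (Fin 2) F ⧸ Subgroup.center (Matrix.SpecialLinearGroup (Fin 2) F)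

/-- `Σ(a)`: the union of the conjugacy classes of all powers of `a`. -/
def conjPowers {G : Type*} [Group G] (a : G) : Set G :=
  {x | ∃ (g : G) (j : ℕ), x = g * a ^ j * g⁻¹}

namespace PSL2Sigma

section Field

variable {F : Type*} [Field F]

local notation "SL₂" => Matrix.SpecialLinearGroup (Fin 2)

/-- The binary quadratic form `v ↦ det (v, M v)` attached to a `2 × 2` matrix `M`. -/
def detForm (M : SL₂ F) (x y : F) : F :=
  M 1 0 * x ^ 2 + (M 1 1 - M 0 0) * (x * y) - M 0 1 * y ^ 2

/-- The normal form of trace `t` whose form `detForm` takes the value `δ` at `(1, 0)`. -/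
def companion (δ t : F) (hδ : δ ≠ 0) : SL₂ F :=
  ⟨!![0, -δ⁻¹; δ, t], by simp [Matrix.det_fin_two, hδ]⟩

lemma det_eq_one (M : SL₂ F) : M 0 0 * M 1 1 - M 0 1 * M 1 0 = 1 := by
  rw [← Matrix.det_fin_two, M.det_coe]

lemma isConj_companion (M : SL₂ F) {x y t δ : F} (hδ : δ ≠ 0)
    (ht : M 0 0 + M 1 1 = t) (h : detForm M x y = δ) : IsConj M (companion δ t hδ) := by
  have hdet := det_eq_one M
  unfold detForm at h
  obtain ⟨P, hP⟩ : ∃ P : SL₂ F, (P : Matrix (Fin 2) (Fin 2) F) =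
      !![x, (M 0 0 * x + M 0 1 * y) / δ; y, (M 1 0 * x + M 1 1 * y) / δ] := by
    refine ⟨⟨_, ?_⟩, rfl⟩
    rw [Matrix.det_fin_two_of]
    field_simp
    linear_combination h
  refine IsConj.symm (isConj_iff.2 ⟨P, ?_⟩)
  rw [mul_inv_eq_iff_eq_mul]
  ext i j
  subst ht
  rw [Matrix.SpecialLinearGroup.coe_mul, Matrix.SpecialLinearGroup.coe_mul, hP]
  fin_cases i <;> fin_cases j <;>
    simp [companion, Matrix.mul_apply, Fin.sum_univ_two] <;> field_simp
  · linear_combination x * hdet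
  · linear_combination y * hdet

lemma mem_center_iff_entries {M : SL₂ F} :
    M ∈ Subgroup.center (SL₂ F) ↔ M 0 1 = 0 ∧ M 1 0 = 0 ∧ M 0 0 = M 1 1 := by
  rw [Matrix.SpecialLinearGroup.mem_center_iff]
  constructor
  · rintro ⟨r, -, h⟩
    simp [← h]
  · rintro ⟨h₁, h₂, h₃⟩
    have := det_eq_one M
    refine ⟨M 0 0, ?_, ?_⟩
    · rw [h₁, ← h₃] at this
      simp only [Fintype.card_fin]
      linear_combination this
    · ext i j
      fin_cases i <;> fin_cases j <;> simp [h₁, h₂, h₃]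

lemma exists_detForm_ne_zero {M : SL₂ F} (hM : M ∉ Subgroup.center (SL₂ F)) :
    ∃ x y, detForm M x y ≠ 0 := by
  contrapose! hM
  have h₁ := hM 1 0
  have h₂ := hM 0 1
  have h₃ := hM 1 1
  simp only [detForm] at h₁ h₂ h₃
  rw [mem_center_iff_entries]
  refine ⟨by linear_combination -h₂, by linear_combination h₁, ?_⟩
  linear_combination h₁ + h₂ - h₃

lemma trace_pow {K : Type*} [CommRing K] {m : Matrix (Fin 2) (Fin 2) K} {l l' : K}
    (htr : m.trace = l + l') (hsq : m * m = (l + l') • m - 1) (hl : l * l' = 1) (k : ℕ) :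
    (m ^ k).trace = l ^ k + l' ^ k := by
  induction k using Nat.twoStepInduction with
  | zero => simp [Matrix.trace_one]; norm_num
  | one => simpa using htr
  | more k h₀ h₁ =>
    have : m ^ (k + 2) = (l + l') • m ^ (k + 1) - m ^ k := by
      rw [pow_add, pow_two, hsq, mul_sub, mul_one, mul_smul_comm, ← pow_succ]
    rw [this, Matrix.trace_sub, Matrix.trace_smul, h₀, h₁, smul_eq_mul]
    linear_combination (l ^ k + l' ^ k) * hl

lemma sub_smul_pow {K : Type*} [CommRing K] {m : Matrix (Fin 2) (Fin 2) K} {l l' : K}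
    (hsq : m * m = (l + l') • m - 1) (hl : l * l' = 1) (k : ℕ) :
    (l - l') • m ^ k = l ^ k • (m - l' • 1) - l' ^ k • (m - l • 1) := by
  induction k with
  | zero => simp only [pow_zero, one_smul]; module
  | succ k ih =>
    have h1 : (1 : Matrix (Fin 2) (Fin 2) K) = (l * l') • 1 := by rw [hl, one_smul]
    rw [pow_succ, ← smul_mul_assoc, ih, sub_mul, smul_mul_assoc, smul_mul_assoc, sub_mul, sub_mul,
      hsq, smul_mul_assoc, smul_mul_assoc, one_mul]
    nth_rewrite 1 2 [h1]
    module

/-- An eigenvalue `l` of `M` in the algebraic closure governs the traces of the powers of `M`,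
and which of these powers are central. -/
lemma exists_eigenvalue (M : SL₂ F) : ∃ l : AlgebraicClosure F, l ≠ 0 ∧
    (∀ k : ℕ, algebraMap F (AlgebraicClosure F) ((M ^ k) 0 0 + (M ^ k) 1 1) = l ^ k + l⁻¹ ^ k) ∧
    ∀ k : ℕ, (l ^ 2) ^ k = 1 → l ^ 2 ≠ 1 → M ^ k ∈ Subgroup.center (SL₂ F) := by
  set φ := algebraMap F (AlgebraicClosure F)
  set t := φ (M 0 0 + M 1 1) with ht
  have hdeg : (Polynomial.X ^ 2 + Polynomial.C (-t) * Polynomial.X + Polynomial.C 1).degree ≠ 0 := by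
    have := Polynomial.degree_quadratic (a := (1 : AlgebraicClosure F)) (b := -t) (c := 1)
      one_ne_zero
    rw [Polynomial.C_1, one_mul] at this
    rw [Polynomial.C_1, this]
    decide
  obtain ⟨l, hl⟩ := IsAlgClosed.exists_root _ hdeg
  simp only [Polynomial.IsRoot, Polynomial.eval_add, Polynomial.eval_mul, Polynomial.eval_pow,
    Polynomial.eval_X, Polynomial.eval_C] at hl
  have hl0 : l ≠ 0 := by
    rintro rfl
    simp at hl
  have hll : l * l⁻¹ = 1 := mul_inv_cancel₀ hl0
  have hsum : l + l⁻¹ = t := by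
    field_simp
    linear_combination hl
  have hmap (k : ℕ) : ((M ^ k : SL₂ F) : Matrix (Fin 2) (Fin 2) F).map φ =
      ((M : Matrix (Fin 2) (Fin 2) F).map φ) ^ k := by
    rw [Matrix.SpecialLinearGroup.coe_pow]
    exact map_pow φ.mapMatrix _ k
  have htr : ((M : Matrix (Fin 2) (Fin 2) F).map φ).trace = l + l⁻¹ := by
    rw [hsum, ht, Matrix.trace_fin_two, map_add]
    rfl
  have hdet := congrArg φ (det_eq_one M)
  simp only [map_sub, map_mul, map_one] at hdet
  have hsq : (M : Matrix (Fin 2) (Fin 2) F).map φ * (M : Matrix (Fin 2) (Fin 2) F).map φ =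
      (l + l⁻¹) • (M : Matrix (Fin 2) (Fin 2) F).map φ - 1 := by
    rw [hsum, ht, map_add]
    ext i j
    fin_cases i <;> fin_cases j <;> simp [Matrix.mul_apply, Fin.sum_univ_two]
    · linear_combination -hdet
    · ring
    · ring
    · linear_combination -hdet
  refine ⟨l, hl0, fun k ↦ ?_, fun k hk hl1 ↦ ?_⟩
  · rw [← trace_pow htr hsq hll, ← hmap, Matrix.trace_fin_two, map_add]
    rfl
  · have hne : l - l⁻¹ ≠ 0 := by
      intro h
      apply hl1
      linear_combination l * h + hll
    have hk' : l⁻¹ ^ k = l ^ k := by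
      have : l ^ k * l⁻¹ ^ k = 1 := by rw [← mul_pow, hll, one_pow]
      have h2 : l ^ k * l ^ k = 1 := by rw [← mul_pow, ← pow_two, hk]
      exact mul_left_cancel₀ (pow_ne_zero k hl0) (this.trans h2.symm)
    have h := sub_smul_pow hsq hll k
    rw [hk', ← hmap] at h
    have h' : (l - l⁻¹) • ((M ^ k : SL₂ F) : Matrix (Fin 2) (Fin 2) F).map φ =
        (l - l⁻¹) • (l ^ k • (1 : Matrix (Fin 2) (Fin 2) (AlgebraicClosure F))) := by
      rw [h]; module
    have h'' := smul_right_injective _ hne h'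
    have e (i j) := congrFun (congrFun h'' i) j
    have e01 := e 0 1
    have e10 := e 1 0
    have e00 := e 0 0
    have e11 := e 1 1
    simp at e01 e10 e00 e11
    rw [mem_center_iff_entries]
    exact ⟨e01, e10, φ.injective (e00.trans e11.symm)⟩

lemma eigenvalue_pow_eq_one {M : SL₂ F} {l : AlgebraicClosure F} (hl : l ≠ 0) {k : ℕ}
    (h : algebraMap F (AlgebraicClosure F) ((M ^ k) 0 0 + (M ^ k) 1 1) = l ^ k + l⁻¹ ^ k)
    (hM : M ^ k ∈ Subgroup.center (SL₂ F)) : (l ^ 2) ^ k = 1 := by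
  set φ := algebraMap F (AlgebraicClosure F)
  obtain ⟨h₁, h₂, h₃⟩ := mem_center_iff_entries.1 hM
  have hdet := congrArg φ (det_eq_one (M ^ k))
  rw [h₁, ← h₃] at hdet
  rw [← h₃] at h
  set c := (M ^ k) 0 0
  simp only [map_mul, map_one, zero_mul, sub_zero, map_add] at hdet h
  have : l ^ k * l⁻¹ ^ k = 1 := by rw [← mul_pow, mul_inv_cancel₀ hl, one_pow]
  have h0 : (l ^ k - φ c) ^ 2 = 0 := by
    linear_combination (-l ^ k) * h + hdet - this
  have h1 := sub_eq_zero.1 (pow_eq_zero_iff two_ne_zero |>.1 h0)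
  rw [← pow_mul, mul_comm, pow_mul, h1]
  linear_combination hdet

lemma sq_eigenvalue_eq_one_iff {M : SL₂ F} {l : AlgebraicClosure F} (hl : l ≠ 0)
    (h : algebraMap F (AlgebraicClosure F) (M 0 0 + M 1 1) = l + l⁻¹) :
    l ^ 2 = 1 ↔ (M 0 0 + M 1 1) ^ 2 = 4 := by
  have hll : l * l⁻¹ = 1 := mul_inv_cancel₀ hl
  rw [← (algebraMap F (AlgebraicClosure F)).injective.eq_iff, map_pow, h]
  simp only [map_ofNat]
  constructor
  · intro h2
    have : l⁻¹ ^ 2 = 1 := by rw [inv_pow, h2, inv_one]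
    linear_combination h2 + this + 2 * hll
  · intro h2
    have h0 : (l ^ 2 - 1) ^ 2 = 0 := by
      linear_combination l ^ 2 * h2 - (l * l⁻¹ + 2 * l ^ 2 + 1) * hll
    exact sub_eq_zero.1 (pow_eq_zero_iff two_ne_zero |>.1 h0)

/-- An element of trace `±2` becomes central on raising it to the characteristic. -/
lemma pow_char_mem_center {p : ℕ} [Fact p.Prime] [CharP F p] {M : SL₂ F}
    (h : (M 0 0 + M 1 1) ^ 2 = 4) : M ^ p ∈ Subgroup.center (SL₂ F) := by
  have hdet := det_eq_one M
  obtain ⟨c, hc, hc'⟩ : ∃ c, M 0 0 + M 1 1 = 2 * c ∧ c ^ 2 = 1 := by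
    by_cases h2 : (2 : F) = 0
    · refine ⟨1, ?_, one_pow 2⟩
      have : (M 0 0 + M 1 1) ^ 2 = 0 := by rw [h]; linear_combination 2 * h2
      rw [pow_eq_zero_iff two_ne_zero |>.1 this, h2, zero_mul]
    · refine ⟨(M 0 0 + M 1 1) / 2, by field_simp, ?_⟩
      rw [div_pow, h]
      field_simp
      norm_num
  have h0 : ((M : Matrix (Fin 2) (Fin 2) F) - Matrix.scalar (Fin 2) c) ^ 2 = 0 := by
    rw [pow_two]
    ext i j
    fin_cases i <;> fin_cases j <;> simp [Matrix.mul_apply, Fin.sum_univ_two]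
    · linear_combination M 0 0 * hc - hdet + hc'
    · linear_combination M 0 1 * hc
    · linear_combination M 1 0 * hc
    · linear_combination M 1 1 * hc - hdet + hc'
  have hp := (Fact.out : p.Prime)
  have h1 := pow_eq_zero_of_le hp.two_le h0
  rw [sub_pow_char_of_commute p (Matrix.scalar_commute c (fun _ ↦ mul_comm _ _) _).symm,
    sub_eq_zero, ← map_pow, ← Matrix.SpecialLinearGroup.coe_pow] at h1
  rw [mem_center_iff_entries, h1]
  simp

/-- The projection from `SL₂` to `PSL₂`. -/
abbrev proj : SL₂ F →* PSL2 F := QuotientGroup.mk' _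

lemma proj_pow_eq_one_iff {M : SL₂ F} {k : ℕ} :
    proj M ^ k = 1 ↔ M ^ k ∈ Subgroup.center (SL₂ F) := by
  rw [← map_pow]
  exact QuotientGroup.eq_one_iff _

lemma proj_eq_one_iff {M : SL₂ F} : proj M = 1 ↔ M ∈ Subgroup.center (SL₂ F) :=
  QuotientGroup.eq_one_iff _

lemma proj_neg (M : SL₂ F) : proj (-M) = proj M := by
  have h : (-1 : SL₂ F) ∈ Subgroup.center (SL₂ F) := by
    rw [mem_center_iff_entries]
    simp
  rw [← neg_one_mul, map_mul, proj_eq_one_iff.2 h, one_mul]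

lemma trace_sq_of_mem_center {M : SL₂ F} (hM : M ∈ Subgroup.center (SL₂ F)) :
    (M 0 0 + M 1 1) ^ 2 = 4 := by
  obtain ⟨h₁, h₂, h₃⟩ := mem_center_iff_entries.1 hM
  have h := det_eq_one M
  linear_combination 4 * h + 4 * M 1 0 * h₁ + (M 0 0 - M 1 1) * h₃

lemma exists_proj_eq_trace_eq_two {M : SL₂ F} (h : (M 0 0 + M 1 1) ^ 2 = 4) :
    ∃ N : SL₂ F, proj N = proj M ∧ N 0 0 + N 1 1 = 2 := by
  have h' : (M 0 0 + M 1 1) ^ 2 = 2 ^ 2 := by rw [h]; norm_num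
  rcases sq_eq_sq_iff_eq_or_eq_neg.1 h' with h | h
  · exact ⟨M, rfl, h⟩
  · refine ⟨-M, proj_neg M, ?_⟩
    simp only [Matrix.SpecialLinearGroup.coe_neg, Matrix.neg_apply]
    linear_combination -h

/-- In `PSL₂` the elements of order divisible by the characteristic `p` have order `p`. -/
lemma orderOf_proj_of_char_dvd {p : ℕ} [Fact p.Prime] [CharP F p] {M : SL₂ F}
    (h0 : orderOf (proj M) ≠ 0) (h : p ∣ orderOf (proj M)) :
    orderOf (proj M) = p ∧ (M 0 0 + M 1 1) ^ 2 = 4 := by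
  have hp := (Fact.out : p.Prime)
  obtain ⟨l, hl0, htr, hcen⟩ := exists_eigenvalue M
  obtain ⟨k, hk⟩ := h
  have hl := eigenvalue_pow_eq_one hl0 (htr _)
    (proj_pow_eq_one_iff.1 (pow_orderOf_eq_one (proj M)))
  have : CharP (AlgebraicClosure F) p := charP_of_injective_algebraMap
    (algebraMap F (AlgebraicClosure F)).injective p
  have hlk : (l ^ 2) ^ k = 1 := by
    rw [hk, mul_comm, pow_mul] at hl
    have : ((l ^ 2) ^ k - 1) ^ p = 0 := by rw [sub_pow_char, hl, one_pow, sub_self]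
    exact sub_eq_zero.1 (pow_eq_zero_iff hp.ne_zero |>.1 this)
  have hsq : (M 0 0 + M 1 1) ^ 2 = 4 := by
    have h1 := htr 1
    simp only [pow_one] at h1
    rw [← sq_eigenvalue_eq_one_iff hl0 h1]
    by_contra hne
    have hdvd := orderOf_dvd_of_pow_eq_one (proj_pow_eq_one_iff.2 (hcen k hlk hne))
    have hk0 : 0 < k := Nat.pos_of_ne_zero (by rintro rfl; exact h0 hk)
    have := Nat.le_of_dvd hk0 hdvd
    have := hp.two_le
    nlinarith
  refine ⟨orderOf_eq_prime (proj_pow_eq_one_iff.2 (pow_char_mem_center hsq)) fun h1 ↦ ?_, hsq⟩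
  rw [h1, orderOf_one] at hk
  exact hp.one_lt.ne' (Nat.dvd_one.1 ⟨k, hk⟩)

lemma coe_pow_of_trace_eq_two {M : SL₂ F} (h : M 0 0 + M 1 1 = 2) (j : ℕ) :
    ((M ^ j : SL₂ F) : Matrix (Fin 2) (Fin 2) F) =
      (j : F) • ((M : Matrix (Fin 2) (Fin 2) F) - 1) + 1 := by
  have hdet := det_eq_one M
  have hsq : (M : Matrix (Fin 2) (Fin 2) F) * M = (2 : F) • (M : Matrix (Fin 2) (Fin 2) F) - 1 := by
    ext i j
    fin_cases i <;> fin_cases j <;> simp [Matrix.mul_apply, Fin.sum_univ_two]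
    · linear_combination M 0 0 * h - hdet
    · linear_combination M 0 1 * h
    · linear_combination M 1 0 * h
    · linear_combination M 1 1 * h - hdet
  induction j with
  | zero => simp
  | succ j ih =>
    rw [pow_succ, Matrix.SpecialLinearGroup.coe_mul, ih, add_mul, smul_mul_assoc, sub_mul, hsq]
    push_cast
    rw [one_mul]
    module

lemma trace_pow_of_trace_eq_two {M : SL₂ F} (h : M 0 0 + M 1 1 = 2) (j : ℕ) :
    (M ^ j) 0 0 + (M ^ j) 1 1 = 2 := by
  rw [coe_pow_of_trace_eq_two h]
  simp
  linear_combination j * h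

lemma detForm_pow_of_trace_eq_two {M : SL₂ F} (h : M 0 0 + M 1 1 = 2) (j : ℕ) (x y : F) :
    detForm (M ^ j) x y = j * detForm M x y := by
  unfold detForm
  rw [coe_pow_of_trace_eq_two h]
  simp
  ring

lemma isConj_of_detForm {M N : SL₂ F} (h : M 0 0 + M 1 1 = N 0 0 + N 1 1) {x y u v s : F}
    (hs : s ≠ 0) (hM : detForm M x y ≠ 0) (hN : detForm N u v = s ^ 2 * detForm M x y) :
    IsConj M N := by
  have h0 : detForm N u v ≠ 0 := hN ▸ mul_ne_zero (pow_ne_zero 2 hs) hM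
  have hx : detForm M (s * x) (s * y) = detForm N u v := by
    rw [hN]
    unfold detForm
    ring
  exact (isConj_companion M h0 h hx).trans (isConj_companion N h0 rfl rfl).symm

/-- A power of a transvection with square exponent is conjugate to the transvection. -/
lemma isConj_pow_self_of_trace_eq_two {M : SL₂ F} (hM : M ∉ Subgroup.center (SL₂ F))
    (h : M 0 0 + M 1 1 = 2) {j : ℕ} (hj : (j : F) ≠ 0) (hsq : IsSquare (j : F)) :
    IsConj M (M ^ j) := by
  obtain ⟨x, y, hxy⟩ := exists_detForm_ne_zero hM
  obtain ⟨s, hs⟩ := hsq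
  refine isConj_of_detForm (h.trans (trace_pow_of_trace_eq_two h j).symm) (s := s) ?_ hxy
    (u := x) (v := y) ?_
  · rintro rfl
    exact hj (by simpa using hs)
  · rw [detForm_pow_of_trace_eq_two h, hs, pow_two]

variable [Fintype F]

/-- Over a finite field the form `x² + t x z + z²` is universal, unless the characteristic is odd
and `t² = 4`. -/
lemma exists_norm_form_eq {t : F} (ht : t ^ 2 ≠ 4 ∨ ringChar F = 2) (c : F) :
    ∃ x z, x ^ 2 + t * x * z + z ^ 2 = c := by
  by_cases h2 : ringChar F = 2
  · obtain ⟨x, hx⟩ := FiniteField.isSquare_of_char_two h2 c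
    exact ⟨x, 0, by rw [hx]; ring⟩
  · have ht4 := ht.resolve_right h2
    have h2' : (2 : F) ≠ 0 := Ring.two_ne_zero h2
    have hc : 1 - t ^ 2 / 4 ≠ 0 := by
      intro h
      apply ht4
      have h4 : (4 : F) ≠ 0 := by
        rw [show (4 : F) = 2 * 2 by norm_num]; exact mul_ne_zero h2' h2'
      field_simp at h
      linear_combination -h
    obtain ⟨a, b, h⟩ := FiniteField.exists_root_sum_quadratic
      (f := Polynomial.X ^ 2 - Polynomial.C c)
      (g := Polynomial.C (1 - t ^ 2 / 4) * Polynomial.X ^ 2)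
      (Polynomial.degree_X_pow_sub_C two_pos c) (Polynomial.degree_C_mul_X_pow 2 hc)
      (FiniteField.odd_card_of_char_ne_two h2)
    simp only [Polynomial.eval_sub, Polynomial.eval_mul, Polynomial.eval_pow, Polynomial.eval_X,
      Polynomial.eval_C] at h
    refine ⟨a - t * b / 2, b, ?_⟩
    have h4 : t * b / 2 * (t * b / 2) = t ^ 2 / 4 * b ^ 2 := by
      rw [show (4 : F) = 2 * 2 by norm_num]; field_simp
    have h5 : t * b / 2 * 2 = t * b := by field_simp
    linear_combination h + h4 - (a - t * b / 2) * h5 - 2 * h4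

lemma isConj_companion_one {M : SL₂ F} {t : F} (hM : M ∉ Subgroup.center (SL₂ F))
    (htr : M 0 0 + M 1 1 = t) (ht : t ^ 2 ≠ 4 ∨ ringChar F = 2) :
    IsConj M (companion 1 t one_ne_zero) := by
  obtain ⟨x, y, h⟩ := exists_detForm_ne_zero hM
  obtain ⟨u, z, huz⟩ := exists_norm_form_eq ht (detForm M x y)⁻¹
  refine (isConj_companion M h htr rfl).trans
    (isConj_companion _ (x := u) (y := detForm M x y * z) one_ne_zero (by simp [companion]) ?_)
  simp only [detForm, companion] at h huz ⊢
  simp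
  set δ := M 1 0 * x ^ 2 + (M 1 1 - M 0 0) * (x * y) - M 0 1 * y ^ 2
  have := congrArg (δ * ·) huz
  simp only [mul_inv_cancel₀ h] at this
  field_simp
  linear_combination this

/-- Noncentral elements of the same trace are conjugate, apart from the case of trace `±2` in odd
characteristic. -/
lemma isConj_of_trace_eq {M N : SL₂ F} (hM : M ∉ Subgroup.center (SL₂ F))
    (hN : N ∉ Subgroup.center (SL₂ F)) (h : M 0 0 + M 1 1 = N 0 0 + N 1 1)
    (ht : (N 0 0 + N 1 1) ^ 2 ≠ 4 ∨ ringChar F = 2) : IsConj M N :=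
  (isConj_companion_one hM h ht).trans (isConj_companion_one hN rfl ht).symm

/-- If the prime field contains a nonsquare, then any two transvections have conjugate powers. -/
lemma exists_isConj_pow_of_not_isSquare {M N : SL₂ F} (hM : M ∉ Subgroup.center (SL₂ F))
    (hN : N ∉ Subgroup.center (SL₂ F)) (hMt : M 0 0 + M 1 1 = 2) (hNt : N 0 0 + N 1 1 = 2)
    {j : ℕ} (hj : ¬ IsSquare (j : F)) : ∃ i : ℕ, IsConj (M ^ i) N := by
  classical
  obtain ⟨x, y, hxy⟩ := exists_detForm_ne_zero hM
  obtain ⟨u, v, huv⟩ := exists_detForm_ne_zero hN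
  have hj0 : (j : F) ≠ 0 := by
    intro h
    exact hj (h ▸ IsSquare.zero)
  obtain ⟨i, hi0, s, hs⟩ : ∃ i : ℕ, (i : F) ≠ 0 ∧
      IsSquare (detForm N u v * (i * detForm M x y)) := by
    by_cases hsq : IsSquare (detForm N u v * detForm M x y)
    · exact ⟨1, by simp, by simpa using hsq⟩
    · refine ⟨j, hj0, ?_⟩
      rw [← quadraticChar_neg_one_iff_not_isSquare] at hsq hj
      rw [mul_left_comm, ← quadraticChar_one_iff_isSquare (by simp [hj0, hxy, huv]), map_mul, hsq,
        hj]
      norm_num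
  have hM0 : (i : F) * detForm M x y ≠ 0 := mul_ne_zero hi0 hxy
  refine ⟨i, isConj_of_detForm ((trace_pow_of_trace_eq_two hMt i).trans hNt.symm)
    (s := s / (i * detForm M x y)) (x := x) (y := y) (u := u) (v := v) ?_ ?_ ?_⟩
  · refine div_ne_zero ?_ hM0
    rintro rfl
    exact mul_ne_zero huv hM0 (by simpa using hs)
  · rwa [detForm_pow_of_trace_eq_two hMt]
  · rw [detForm_pow_of_trace_eq_two hMt, div_pow, pow_two s, ← hs]
    field_simp

lemma isConj_proj_of_trace_sq_eq {M N : SL₂ F} (h : (M 0 0 + M 1 1) ^ 2 = (N 0 0 + N 1 1) ^ 2)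
    (hN : (N 0 0 + N 1 1) ^ 2 ≠ 4) : IsConj (proj M) (proj N) := by
  have hM : (M 0 0 + M 1 1) ^ 2 ≠ 4 := h ▸ hN
  have hMc := mt trace_sq_of_mem_center hM
  have hNc := mt trace_sq_of_mem_center hN
  rcases sq_eq_sq_iff_eq_or_eq_neg.1 h with h | h
  · exact proj.map_isConj (isConj_of_trace_eq hMc hNc h (Or.inl hN))
  · have hneg : (-M) 0 0 + (-M) 1 1 = N 0 0 + N 1 1 := by
      simp only [Matrix.SpecialLinearGroup.coe_neg, Matrix.neg_apply]
      linear_combination -h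
    rw [← proj_neg M]
    refine proj.map_isConj (isConj_of_trace_eq ?_ hNc hneg (Or.inl hN))
    rw [← proj_eq_one_iff, proj_neg, proj_eq_one_iff]
    exact hMc

/-- Subgroups of `PSL₂` of the same prime order different from the characteristic are conjugate. -/
lemma exists_isConj_pow_of_pow_eq_one {M N : SL₂ F} {r : ℕ} (hr : r.Prime)
    (hM : (M 0 0 + M 1 1) ^ 2 ≠ 4) (hN : (N 0 0 + N 1 1) ^ 2 ≠ 4)
    (hMr : proj M ^ r = 1) (hNr : proj N ^ r = 1) : ∃ j : ℕ, IsConj (proj M ^ j) (proj N) := by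
  obtain ⟨l, hl0, hltr, -⟩ := exists_eigenvalue M
  obtain ⟨m, hm0, hmtr, -⟩ := exists_eigenvalue N
  have hlr := eigenvalue_pow_eq_one hl0 (hltr r) (proj_pow_eq_one_iff.1 hMr)
  have hmr := eigenvalue_pow_eq_one hm0 (hmtr r) (proj_pow_eq_one_iff.1 hNr)
  have hm1 := hmtr 1
  have hl1 := hltr 1
  simp only [pow_one] at hm1 hl1
  rw [ne_eq, ← sq_eigenvalue_eq_one_iff hl0 hl1] at hM
  have : Fact r.Prime := ⟨hr⟩
  have : NeZero r := ⟨hr.ne_zero⟩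
  obtain ⟨j, -, hj⟩ := (IsPrimitiveRoot.iff_orderOf.2
    (orderOf_eq_prime hlr hM)).eq_pow_of_pow_eq_one hmr
  refine ⟨j, ?_⟩
  rw [← map_pow]
  refine isConj_proj_of_trace_sq_eq ?_ hN
  apply (algebraMap F (AlgebraicClosure F)).injective
  rw [map_pow, map_pow, hltr, hm1]
  have h1 : l ^ j * l⁻¹ ^ j = 1 := by rw [← mul_pow, mul_inv_cancel₀ hl0, one_pow]
  have h2 : m * m⁻¹ = 1 := mul_inv_cancel₀ hm0
  have h3 : (l⁻¹ ^ j) ^ 2 = m⁻¹ ^ 2 := by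
    rw [inv_pow m, ← hj]
    simp only [inv_pow]
    rw [← pow_mul, ← pow_mul, mul_comm]
  rw [← pow_mul, mul_comm, pow_mul] at hj
  linear_combination hj + h3 + 2 * h1 - 2 * h2

lemma isSquare_natCast_of_even {p e : ℕ} [Fact p.Prime] [CharP F p] (hp : Odd p) (he : Even e)
    (hF : Fintype.card F = p ^ e) {j : ℕ} (hj : (j : F) ≠ 0) : IsSquare (j : F) := by
  have h2 : ringChar F ≠ 2 := by
    rw [ringChar.eq F p]
    rintro rfl
    exact absurd hp (by decide)
  rw [FiniteField.isSquare_iff h2 hj, hF]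
  obtain ⟨f, rfl⟩ := he
  obtain ⟨m, hm⟩ := hp.pow (n := f)
  have hfix : (j : F) ^ p ^ f = j := by
    have := map_natCast (iterateFrobenius F p f) j
    rwa [iterateFrobenius_def] at this
  have h1 : (j : F) ^ (2 * m) = 1 := by
    rw [hm, pow_succ] at hfix
    exact mul_right_cancel₀ hj (hfix.trans (one_mul _).symm)
  have hdiv : p ^ (f + f) / 2 = 2 * m * (m + 1) := by
    rw [pow_add, hm]
    have : (2 * m + 1) * (2 * m + 1) = 2 * (2 * m * (m + 1)) + 1 := by ring
    omega
  rw [hdiv, pow_mul, h1, one_pow]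

lemma exists_natCast_not_isSquare {p e : ℕ} [Fact p.Prime] [CharP F p] (hp : Odd p) (he : Odd e)
    (hF : Fintype.card F = p ^ e) : ∃ j : ℕ, ¬ IsSquare (j : F) := by
  have hp2 : p ≠ 2 := by
    rintro rfl
    exact absurd hp (by decide)
  have h2 : ringChar (ZMod p) ≠ 2 := by rwa [ringChar.eq (ZMod p) p]
  obtain ⟨a, ha⟩ := FiniteField.exists_nonsquare h2
  have ha0 : a ≠ 0 := by
    rintro rfl
    exact ha IsSquare.zero
  refine ⟨a.val, ?_⟩
  rintro ⟨x, hx⟩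
  have hcast : (a.val : F) = ZMod.castHom dvd_rfl F a := by
    rw [ZMod.castHom_apply, ZMod.natCast_val]
  have hpow : (a.val : F) ^ (p / 2) = -1 := by
    rw [ZMod.euler_criterion p ha0] at ha
    rw [hcast, ← map_pow, (ZMod.pow_div_two_eq_neg_one_or_one p ha0).resolve_left ha, map_neg,
      map_one]
  obtain ⟨m, hm⟩ := hp
  have hxp : x ^ p = -x := by
    rw [hx, hm, ← pow_two, ← pow_mul, show 2 * ((2 * m + 1) / 2) = 2 * m by omega] at hpow
    rw [hm, pow_succ, hpow, neg_one_mul]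
  have hiter (n : ℕ) : x ^ p ^ n = (-1) ^ n * x := by
    induction n with
    | zero => simp
    | succ n ih =>
      rw [pow_succ, pow_mul, ih, mul_pow, hxp, ← pow_mul, mul_comm n, pow_mul,
        Odd.neg_one_pow ⟨m, hm⟩]
      ring
  have hxx := hiter e
  rw [← hF, FiniteField.pow_card, he.neg_one_pow] at hxx
  have h2F : (2 : F) ≠ 0 := Ring.two_ne_zero (by rwa [ringChar.eq F p])
  have hx0 : x = 0 := by
    have : 2 * x = 0 := by linear_combination hxx
    exact (mul_eq_zero.1 this).resolve_left h2F
  rw [hx0, mul_zero, hcast, map_eq_zero] at hx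
  exact ha0 hx

lemma conjPowers_inter_eq_one_iff {G : Type*} [Group G] {a b : G} :
    conjPowers a ∩ conjPowers b = {1} ↔ ∀ i k : ℕ, IsConj (a ^ i) (b ^ k) → b ^ k = 1 := by
  constructor
  · intro h i k hik
    obtain ⟨g, hg⟩ := isConj_iff.1 hik
    exact h.subset ⟨⟨g, i, hg.symm⟩, ⟨1, k, by simp⟩⟩
  · intro h
    refine Set.Subset.antisymm ?_ (Set.singleton_subset_iff.2
      ⟨⟨1, 0, by simp⟩, ⟨1, 0, by simp⟩⟩)
    rintro x ⟨⟨g, i, rfl⟩, ⟨g', k, hk⟩⟩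
    have h1 := h i k ((isConj_iff.2 ⟨g, rfl⟩).trans (isConj_iff.2 ⟨g', hk.symm⟩).symm)
    simp [hk, h1]

end Field

end PSL2Sigma

open PSL2Sigma

/-- Let `G = PSL₂(q)`, `q = p ^ e`, and `A₁, A₂ ∈ G`.  Then
`Σ(A₁) ∩ Σ(A₂) = {1}` iff either the orders of `A₁` and `A₂` are coprime, or `p` is odd,
`e` is even, both `A₁` and `A₂` have order `p` and they are not conjugate in `G`. -/
theorem sigma_inter_trivial_iff_PSL2 (p e : ℕ) (hp : p.Prime) (he : 0 < e)
    (F : Type*) [Field F] [Fintype F] (hF : Fintype.card F = p ^ e)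
    (A₁ A₂ : PSL2 F) :
    conjPowers A₁ ∩ conjPowers A₂ = {1} ↔
      (Nat.Coprime (orderOf A₁) (orderOf A₂) ∨
        (Odd p ∧ Even e ∧ orderOf A₁ = p ∧ orderOf A₂ = p ∧ ¬ IsConj A₁ A₂)) := by

  have : Fact p.Prime := ⟨hp⟩
  have : CharP F p := charP_of_card_eq_prime_pow hF
  obtain ⟨M₁, rfl⟩ : ∃ M, proj M = A₁ := QuotientGroup.mk'_surjective _ A₁
  obtain ⟨M₂, rfl⟩ : ∃ M, proj M = A₂ := QuotientGroup.mk'_surjective _ A₂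
  have hn₁ : orderOf (proj M₁) ≠ 0 := (orderOf_pos _).ne'
  have hn₂ : orderOf (proj M₂) ≠ 0 := (orderOf_pos _).ne'
  rw [conjPowers_inter_eq_one_iff]
  constructor
  · intro h
    refine or_iff_not_imp_left.2 fun hcop ↦ ?_
    obtain ⟨r, hr, hr₁, hr₂⟩ := Nat.Prime.not_coprime_iff_dvd.1 hcop
    obtain rfl | hrp := eq_or_ne r p
    · obtain ⟨ho₁, ht₁⟩ := orderOf_proj_of_char_dvd hn₁ hr₁
      obtain ⟨ho₂, ht₂⟩ := orderOf_proj_of_char_dvd hn₂ hr₂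
      obtain ⟨N₁, hN₁, htr₁⟩ := exists_proj_eq_trace_eq_two ht₁
      obtain ⟨N₂, hN₂, htr₂⟩ := exists_proj_eq_trace_eq_two ht₂
      have hne₁ : proj M₁ ≠ 1 := fun h1 ↦ hr.one_lt.ne' (by rw [← ho₁, h1, orderOf_one])
      have hne₂ : proj M₂ ≠ 1 := fun h1 ↦ hr.one_lt.ne' (by rw [← ho₂, h1, orderOf_one])
      have hc₁ : N₁ ∉ Subgroup.center _ := by rwa [← proj_eq_one_iff, hN₁]
      have hc₂ : N₂ ∉ Subgroup.center _ := by rwa [← proj_eq_one_iff, hN₂]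
      have hnot (i : ℕ) : ¬ IsConj (N₁ ^ i) N₂ := fun hc ↦ hne₂ <| by
        have hc' := proj.map_isConj hc
        rw [map_pow, hN₁, hN₂] at hc'
        simpa using h i 1 (by simpa using hc')
      have hodd : Odd r := by
        refine hr.odd_of_ne_two fun h2 ↦ hnot 1 ?_
        rw [pow_one]
        exact isConj_of_trace_eq hc₁ hc₂ (htr₁.trans htr₂.symm)
          (Or.inr ((ringChar.eq F r).trans h2))
      refine ⟨hodd, ?_, ho₁, ho₂, fun hc ↦ hne₂ (by simpa using h 1 1 (by simpa using hc))⟩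
      by_contra he'
      obtain ⟨j, hj⟩ := exists_natCast_not_isSquare hodd (Nat.not_even_iff_odd.1 he') hF
      obtain ⟨i, hi⟩ := exists_isConj_pow_of_not_isSquare hc₁ hc₂ htr₁ htr₂ hj
      exact hnot i hi
    · have key (M : Matrix.SpecialLinearGroup (Fin 2) F) (h0 : orderOf (proj M) ≠ 0)
          (hd : r ∣ orderOf (proj M)) :
          ∃ (N : Matrix.SpecialLinearGroup (Fin 2) F) (k : ℕ), proj N = proj M ^ k ∧
            orderOf (proj N) = r ∧ (N 0 0 + N 1 1) ^ 2 ≠ 4 := by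
        have ho := orderOf_pow_orderOf_div h0 hd
        refine ⟨M ^ (orderOf (proj M) / r), _, map_pow _ _ _, by rwa [map_pow], fun h4 ↦ hrp ?_⟩
        have h1 := orderOf_dvd_of_pow_eq_one
          (proj_pow_eq_one_iff.2 (pow_char_mem_center (p := p) h4))
        rw [map_pow, ho] at h1
        exact (Nat.prime_dvd_prime_iff_eq hr hp).1 h1
      obtain ⟨N₁, k₁, hN₁, ho₁, ht₁⟩ := key M₁ hn₁ hr₁
      obtain ⟨N₂, k₂, hN₂, ho₂, ht₂⟩ := key M₂ hn₂ hr₂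
      obtain ⟨j, hj⟩ := exists_isConj_pow_of_pow_eq_one hr ht₁ ht₂
        (ho₁ ▸ pow_orderOf_eq_one _) (ho₂ ▸ pow_orderOf_eq_one _)
      rw [hN₁, hN₂, ← pow_mul] at hj
      rw [hN₂, h _ _ hj, orderOf_one] at ho₂
      exact absurd ho₂ hr.one_lt.ne
  · rintro (hcop | ⟨hodd, heven, ho₁, ho₂, hnc⟩) i k hik
    · obtain ⟨g, hg⟩ := isConj_iff.1 hik
      rw [← orderOf_eq_one_iff]
      refine Nat.eq_one_of_dvd_coprimes hcop ?_ (orderOf_pow_dvd k)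
      rw [← hg]
      apply orderOf_dvd_of_pow_eq_one
      rw [conj_pow, pow_right_comm, pow_orderOf_eq_one, one_pow, mul_one, mul_inv_cancel]
    · by_contra hk
      have key (M : Matrix.SpecialLinearGroup (Fin 2) F) (ho : orderOf (proj M) = p) (j : ℕ)
          (hj : proj M ^ j ≠ 1) : IsConj (proj M) (proj M ^ j) := by
        have h0 : (j : F) ≠ 0 := by
          rwa [ne_eq, CharP.cast_eq_zero_iff F p, ← ho, orderOf_dvd_iff_pow_eq_one]
        obtain ⟨-, ht⟩ := orderOf_proj_of_char_dvd (p := p) (ho ▸ hp.ne_zero) ho.symm.dvd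
        obtain ⟨N, hN, htr⟩ := exists_proj_eq_trace_eq_two ht
        have hc : N ∉ Subgroup.center _ := by
          rw [← proj_eq_one_iff, hN]
          intro h1
          rw [h1, orderOf_one] at ho
          exact hp.one_lt.ne ho
        rw [← hN, ← map_pow]
        exact proj.map_isConj (isConj_pow_self_of_trace_eq_two hc htr h0
          (isSquare_natCast_of_even hodd heven hF h0))
      refine hnc ((key M₁ ho₁ i fun h1 ↦ hk ?_).trans (hik.trans (key M₂ ho₂ k hk).symm))
      rw [h1] at hik
      exact isConj_one_right.1 hik
end

section
/- Let G₁ = PGL₂(q) where q = p^e for an odd prime p and a positive integer e, and let A₁, A₂ ∈ G₁. Then Σ(A₁) ∩ Σ(A₂) = {1} if and only if one of the following holds: (a) the orders of A₁ and A₂ are relatively prime; (b) A₁ is split, A₂ is non-split, and gcd(|A₁|,|A₂|) = 2; (c) A₁ is non-split, A₂ is split, and gcd(|A₁|,|A₂|) = 2. -/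
open Matrix Polynomial

/-- The projective general linear group `PGL₂(F) = GL(2, F) / Z(GL(2, F))`. -/
abbrev PGL2 (F : Type*) [Field F] :=
  Matrix.GeneralLinearGroup (Fin 2) F ⧸ Subgroup.center (Matrix.GeneralLinearGroup (Fin 2) F)

/-- A non-trivial element of `PGL₂(F)` is *split* if some lift of it to `GL(2, F)` has
characteristic polynomial with two distinct roots in `F`. -/
def IsSplit {F : Type*} [Field F] (A : PGL2 F) : Prop :=
  A ≠ 1 ∧ ∃ M : Matrix.GeneralLinearGroup (Fin 2) F,
    (QuotientGroup.mk M : PGL2 F) = A ∧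
      ∃ a b : F, a ≠ b ∧ (Matrix.charpoly (M : Matrix (Fin 2) (Fin 2) F)).IsRoot a ∧
        (Matrix.charpoly (M : Matrix (Fin 2) (Fin 2) F)).IsRoot b

/-- A non-trivial element of `PGL₂(F)` is *non-split* if some lift of it to `GL(2, F)` has
irreducible characteristic polynomial over `F`. -/
def IsNonSplit {F : Type*} [Field F] (A : PGL2 F) : Prop :=
  A ≠ 1 ∧ ∃ M : Matrix.GeneralLinearGroup (Fin 2) F,
    (QuotientGroup.mk M : PGL2 F) = A ∧
      Irreducible (Matrix.charpoly (M : Matrix (Fin 2) (Fin 2) F))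

section Conjugacy

variable {F : Type*} [Field F]

theorem exists_mul_eq_mul_companion {m : Matrix (Fin 2) (Fin 2) F}
    (hm : m ∉ Set.range (Matrix.scalar (Fin 2))) :
    ∃ P : GL (Fin 2) F, m * P.val = P.val * !![0, -m.det; 1, m.trace] := by
  by_cases h10 : m 1 0 = 0
  · by_cases h01 : m 0 1 = 0
    · have hne : m 1 1 - m 0 0 ≠ 0 := by
        intro h
        refine hm ⟨m 0 0, ?_⟩
        ext i j
        fin_cases i <;> fin_cases j <;> simp [h10, h01]
        linear_combination -h
      refine ⟨GeneralLinearGroup.mkOfDetNeZero !![1, m 0 0; 1, m 1 1] (by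
        simpa [det_fin_two] using hne), ?_⟩
      ext i j
      fin_cases i <;> fin_cases j <;>
        simp [GeneralLinearGroup.mkOfDetNeZero, Matrix.mul_apply, Fin.sum_univ_two, det_fin_two,
          trace_fin_two, h10, h01] <;> ring
    · refine ⟨GeneralLinearGroup.mkOfDetNeZero !![0, m 0 1; 1, m 1 1] (by
        simpa [det_fin_two] using h01), ?_⟩
      ext i j
      fin_cases i <;> fin_cases j <;>
        simp [GeneralLinearGroup.mkOfDetNeZero, Matrix.mul_apply, Fin.sum_univ_two, det_fin_two,
          trace_fin_two, h10] <;> ring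
  · refine ⟨GeneralLinearGroup.mkOfDetNeZero !![1, m 0 0; 0, m 1 0] (by
      simpa [det_fin_two] using h10), ?_⟩
    ext i j
    fin_cases i <;> fin_cases j <;>
      simp [GeneralLinearGroup.mkOfDetNeZero, Matrix.mul_apply, Fin.sum_univ_two, det_fin_two,
        trace_fin_two] <;> ring

theorem exists_conj_of_trace_eq_of_det_eq {m n : Matrix (Fin 2) (Fin 2) F}
    (hm : m ∉ Set.range (Matrix.scalar (Fin 2))) (hn : n ∉ Set.range (Matrix.scalar (Fin 2)))
    (ht : n.trace = m.trace) (hd : n.det = m.det) :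
    ∃ g : GL (Fin 2) F, n * g.val = g.val * m := by
  obtain ⟨P, hP⟩ := exists_mul_eq_mul_companion hm
  obtain ⟨Q, hQ⟩ := exists_mul_eq_mul_companion hn
  rw [ht, hd] at hQ
  refine ⟨Q * P⁻¹, ?_⟩
  have hC : !![0, -m.det; 1, m.trace] = P⁻¹.val * m * P.val := by
    rw [mul_assoc, hP, ← mul_assoc, Units.inv_mul, one_mul]
  rw [hC] at hQ
  calc n * (Q * P⁻¹).val = n * Q.val * P⁻¹.val := by rw [Units.val_mul, mul_assoc]
    _ = Q.val * P⁻¹.val * m * (P.val * P⁻¹.val) := by rw [hQ]; simp only [mul_assoc]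
    _ = (Q * P⁻¹).val * m := by rw [Units.mul_inv, mul_one, Units.val_mul]

theorem mk_eq_one_iff_mem_range_scalar {M : GL (Fin 2) F} :
    (QuotientGroup.mk M : PGL2 F) = 1 ↔ M.val ∈ Set.range (Matrix.scalar (Fin 2)) := by
  rw [QuotientGroup.eq_one_iff, GeneralLinearGroup.mem_center_iff_val_mem_range_scalar]

theorem mk_eq_mk_of_val_eq_smul {M N : GL (Fin 2) F} {c : F} (h : N.val = c • M.val) :
    (QuotientGroup.mk N : PGL2 F) = QuotientGroup.mk M := by
  rw [eq_comm, QuotientGroup.eq, GeneralLinearGroup.mem_center_iff_val_mem_range_scalar]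
  refine ⟨c, ?_⟩
  rw [Units.val_mul, h, mul_smul_comm, Units.inv_mul, scalar_apply, smul_one_eq_diagonal]

theorem exists_val_eq_smul_of_mk_eq_mk {M N : GL (Fin 2) F}
    (h : (QuotientGroup.mk N : PGL2 F) = QuotientGroup.mk M) :
    ∃ c : F, c ≠ 0 ∧ N.val = c • M.val := by
  rw [eq_comm, QuotientGroup.eq, GeneralLinearGroup.mem_center_iff_val_mem_range_scalar] at h
  obtain ⟨c, hc⟩ := h
  have hN : N.val = c • M.val := by
    rw [Units.val_mul, scalar_apply, ← smul_one_eq_diagonal] at hc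
    rw [← one_mul N.val, ← Units.mul_inv M, mul_assoc, ← hc, mul_smul_comm, mul_one]
  refine ⟨c, ?_, hN⟩
  rintro rfl
  rw [zero_smul] at hN
  exact N.ne_zero hN

theorem isConj_mk_of_trace_det {M N : GL (Fin 2) F}
    (hM : (QuotientGroup.mk M : PGL2 F) ≠ 1) (hN : (QuotientGroup.mk N : PGL2 F) ≠ 1)
    {c : F} (hc : c ≠ 0) (ht : N.val.trace = c * M.val.trace)
    (hd : N.val.det = c ^ 2 * M.val.det) :
    ∃ g : PGL2 F, (QuotientGroup.mk N : PGL2 F) = g * QuotientGroup.mk M * g⁻¹ := by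
  rw [Ne, mk_eq_one_iff_mem_range_scalar] at hM hN
  have hcM : c • M.val ∉ Set.range (Matrix.scalar (Fin 2)) := by
    rintro ⟨a, ha⟩
    refine hM ⟨c⁻¹ * a, ?_⟩
    rw [← inv_smul_smul₀ hc M.val, ← ha, scalar_apply, scalar_apply, ← smul_one_eq_diagonal,
      ← smul_one_eq_diagonal, smul_smul]
  obtain ⟨g, hg⟩ := exists_conj_of_trace_eq_of_det_eq hcM hN (by simp [ht]) (by simp [hd])
  refine ⟨QuotientGroup.mk g, ?_⟩
  rw [← QuotientGroup.mk_inv, ← QuotientGroup.mk_mul, ← QuotientGroup.mk_mul]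
  refine mk_eq_mk_of_val_eq_smul (c := c) ?_
  calc N.val = N.val * g.val * g⁻¹.val := by rw [mul_assoc, Units.mul_inv, mul_one]
    _ = c • (g * M * g⁻¹).val := by
      rw [hg, Units.val_mul, Units.val_mul, mul_smul_comm, smul_mul_assoc]

/-- Two non-trivial elements of `PGL₂(F)` with the same invariant `tr² / det`, and whose
discriminants agree up to a nonzero square, are conjugate. -/
theorem isConj_mk_of_discr (h2 : (2 : F) ≠ 0) {M N : GL (Fin 2) F}
    (hM : (QuotientGroup.mk M : PGL2 F) ≠ 1) (hN : (QuotientGroup.mk N : PGL2 F) ≠ 1)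
    (hτ : M.val.trace ^ 2 * N.val.det = N.val.trace ^ 2 * M.val.det)
    {s : F} (hs : s ≠ 0) (hD : N.val.discr = s ^ 2 * M.val.discr) :
    ∃ g : PGL2 F, (QuotientGroup.mk N : PGL2 F) = g * QuotientGroup.mk M * g⁻¹ := by
  have hdM : M.val.det ≠ 0 := M.det_ne_zero
  have hdN : N.val.det ≠ 0 := N.det_ne_zero
  have h4 : (4 : F) ≠ 0 := by
    rw [show (4 : F) = 2 * 2 by norm_num]
    exact mul_ne_zero h2 h2
  by_cases h0 : M.val.discr = 0
  · rw [h0, mul_zero] at hD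
    rw [discr_fin_two] at h0 hD
    have htM : M.val.trace ≠ 0 := by
      intro h
      rw [h] at h0
      exact mul_ne_zero h4 hdM (by linear_combination -h0)
    have htN : N.val.trace ≠ 0 := by
      intro h
      rw [h] at hD
      exact mul_ne_zero h4 hdN (by linear_combination -hD)
    refine isConj_mk_of_trace_det hM hN (div_ne_zero htN htM) (by field_simp) ?_
    field_simp
    linear_combination hτ
  · have hd : N.val.det = s ^ 2 * M.val.det := by
      refine mul_left_cancel₀ h0 ?_
      rw [discr_fin_two] at hD ⊢
      rw [discr_fin_two] at hD
      linear_combination hτ + M.val.det * hD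
    have ht : N.val.trace ^ 2 = (s * M.val.trace) ^ 2 := by
      rw [discr_fin_two, discr_fin_two] at hD
      linear_combination hD + 4 * hd
    rcases sq_eq_sq_iff_eq_or_eq_neg.mp ht with h | h
    · exact isConj_mk_of_trace_det hM hN hs h hd
    · exact isConj_mk_of_trace_det hM hN (neg_ne_zero.mpr hs) (by rw [h, neg_mul])
        (by rw [hd, neg_sq])

end Conjugacy

section Powers

variable {F : Type*} [Field F]

theorem sq_eq_trace_smul_sub_det (m : Matrix (Fin 2) (Fin 2) F) :
    m ^ 2 = m.trace • m - m.det • 1 := by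
  ext i j
  fin_cases i <;> fin_cases j <;>
    simp [sq, Matrix.mul_apply, Fin.sum_univ_two, det_fin_two, trace_fin_two] <;> ring

/-- Powers of a `2 × 2` matrix are linear combinations of the identity and the matrix, and
its eigenvalues satisfy the same relation. -/
theorem exists_pow_eq_add_smul (K : Type*) [Field K] [Algebra F K]
    (m : Matrix (Fin 2) (Fin 2) F) (j : ℕ) :
    ∃ a b : F, m ^ j = a • 1 + b • m ∧ ∀ x : K,
      x ^ 2 = algebraMap F K m.trace * x - algebraMap F K m.det →
        x ^ j = algebraMap F K a + algebraMap F K b * x := by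
  induction j with
  | zero => exact ⟨1, 0, by simp, by simp⟩
  | succ j ih =>
    obtain ⟨a, b, hm, hx⟩ := ih
    refine ⟨-(b * m.det), a + b * m.trace, ?_, fun x h ↦ ?_⟩
    · rw [pow_succ, hm, add_mul, smul_mul_assoc, one_mul, smul_mul_assoc, ← sq,
        sq_eq_trace_smul_sub_det]
      module
    · rw [pow_succ, hx x h]
      simp only [map_neg, map_mul, map_add]
      linear_combination algebraMap F K b * h

theorem discr_smul_one_add_smul (m : Matrix (Fin 2) (Fin 2) F) (a b : F) :
    (a • 1 + b • m).discr = b ^ 2 * m.discr := by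
  simp only [discr_fin_two, trace_fin_two, det_fin_two, Matrix.add_apply, Matrix.smul_apply,
    Matrix.one_apply, smul_eq_mul]
  simp
  ring

/-- The discriminant of a nonscalar conjugate of a power agrees with the original discriminant
up to a nonzero square. -/
theorem exists_discr_eq_sq_mul {M N : GL (Fin 2) F} {j : ℕ} {g : PGL2 F}
    (h : (QuotientGroup.mk N : PGL2 F) = g * (QuotientGroup.mk M) ^ j * g⁻¹)
    (hN : (QuotientGroup.mk N : PGL2 F) ≠ 1) :
    ∃ c : F, c ≠ 0 ∧ N.val.discr = c ^ 2 * M.val.discr := by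
  obtain ⟨P, rfl⟩ := QuotientGroup.mk_surjective g
  obtain ⟨a, b, hab, -⟩ := exists_pow_eq_add_smul F M.val j
  have hb : b ≠ 0 := by
    rintro rfl
    have : (QuotientGroup.mk (M ^ j) : PGL2 F) = 1 := by
      rw [mk_eq_one_iff_mem_range_scalar]
      exact ⟨a, by rw [Units.val_pow_eq_pow_val, hab, zero_smul, add_zero, scalar_apply,
        smul_one_eq_diagonal]⟩
    rw [QuotientGroup.mk_pow] at this
    rw [this, mul_one, mul_inv_cancel] at h
    exact hN h
  rw [← QuotientGroup.mk_pow, ← QuotientGroup.mk_inv, ← QuotientGroup.mk_mul,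
    ← QuotientGroup.mk_mul] at h
  obtain ⟨c, hc, hN'⟩ := exists_val_eq_smul_of_mk_eq_mk h
  refine ⟨c * b, mul_ne_zero hc hb, ?_⟩
  have hsm := discr_smul_one_add_smul (P * M ^ j * P⁻¹).val 0 c
  rw [zero_smul, zero_add] at hsm
  rw [hN', hsm, Units.val_mul, Units.val_mul, coe_units_inv, discr_conj,
    Units.val_pow_eq_pow_val, hab, discr_smul_one_add_smul]
  ring

theorem exists_discr_pow_eq_sq_mul {M : GL (Fin 2) F} {j : ℕ}
    (h : (QuotientGroup.mk M : PGL2 F) ^ j ≠ 1) :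
    ∃ c : F, c ≠ 0 ∧ (M ^ j).val.discr = c ^ 2 * M.val.discr :=
  exists_discr_eq_sq_mul (j := j) (g := 1) (by simp) (by simpa using h)

end Powers

section Splitting

variable {F : Type*} [Field F]

theorem mk_ne_one_of_discr_ne_zero {M : GL (Fin 2) F} (hD : M.val.discr ≠ 0) :
    (QuotientGroup.mk M : PGL2 F) ≠ 1 := by
  rw [Ne, mk_eq_one_iff_mem_range_scalar]
  rintro ⟨a, ha⟩
  apply hD
  have := discr_smul_one_add_smul M.val a 0
  rwa [zero_smul, add_zero, smul_one_eq_diagonal, ← scalar_apply, ha, zero_pow two_ne_zero,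
    zero_mul] at this

theorem isRoot_charpoly_fin_two_iff (m : Matrix (Fin 2) (Fin 2) F) (x : F) :
    m.charpoly.IsRoot x ↔ x ^ 2 = m.trace * x - m.det := by
  rw [charpoly_fin_two, IsRoot]
  simp only [eval_add, eval_sub, eval_pow, eval_X, eval_mul, eval_C]
  constructor <;> intro h <;> linear_combination h

theorem exists_isRoot_charpoly_iff_isSquare_discr (h2 : (2 : F) ≠ 0)
    (m : Matrix (Fin 2) (Fin 2) F) :
    (∃ x, m.charpoly.IsRoot x) ↔ IsSquare m.discr := by
  simp only [isRoot_charpoly_fin_two_iff, discr_fin_two]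
  constructor
  · rintro ⟨x, hx⟩
    exact ⟨2 * x - m.trace, by linear_combination -4 * hx⟩
  · rintro ⟨s, hs⟩
    refine ⟨(m.trace + s) / 2, ?_⟩
    field_simp
    linear_combination -hs

theorem isSplit_mk_iff (h2 : (2 : F) ≠ 0) (M : GL (Fin 2) F) :
    IsSplit (QuotientGroup.mk M : PGL2 F) ↔ M.val.discr ≠ 0 ∧ IsSquare M.val.discr := by
  constructor
  · rintro ⟨-, N, hN, a, b, hab, ha, hb⟩
    obtain ⟨c, hc, h⟩ := exists_val_eq_smul_of_mk_eq_mk hN.symm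
    have hsm := discr_smul_one_add_smul N.val 0 c
    rw [zero_smul, zero_add, ← h] at hsm
    rw [isRoot_charpoly_fin_two_iff] at ha hb
    have ht : N.val.trace = a + b := by
      refine mul_left_cancel₀ (sub_ne_zero.mpr hab) ?_
      linear_combination hb - ha
    have hD : M.val.discr = (c * (a - b)) ^ 2 := by
      rw [hsm, discr_fin_two]
      rw [ht] at ha ⊢
      linear_combination -4 * c ^ 2 * ha
    rw [hD]
    exact ⟨pow_ne_zero 2 (mul_ne_zero hc (sub_ne_zero.mpr hab)), IsSquare.sq _⟩
  · rintro ⟨hD, s, hs⟩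
    refine ⟨mk_ne_one_of_discr_ne_zero hD, M, rfl, (M.val.trace + s) / 2, (M.val.trace - s) / 2,
      ?_, ?_, ?_⟩
    · intro h
      field_simp at h
      have h' : 2 * s = 0 := by linear_combination h
      rw [mul_eq_zero, or_iff_right h2] at h'
      rw [hs, h', mul_zero] at hD
      exact hD rfl
    all_goals
      rw [isRoot_charpoly_fin_two_iff]
      rw [discr_fin_two] at hs
      field_simp
      linear_combination -hs

theorem isNonSplit_mk_iff (h2 : (2 : F) ≠ 0) (M : GL (Fin 2) F) :
    IsNonSplit (QuotientGroup.mk M : PGL2 F) ↔ ¬ IsSquare M.val.discr := by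
  have key : ∀ N : GL (Fin 2) F, Irreducible N.val.charpoly ↔ ¬ IsSquare N.val.discr := by
    intro N
    have hdeg : N.val.charpoly.natDegree = 2 := by simp [charpoly_natDegree_eq_dim]
    rw [irreducible_iff_roots_eq_zero_of_degree_le_three hdeg.ge (by omega),
      ← exists_isRoot_charpoly_iff_isSquare_discr h2, Multiset.eq_zero_iff_forall_notMem, not_exists]
    simp only [mem_roots N.val.charpoly_monic.ne_zero]
  constructor
  · rintro ⟨-, N, hN, hirr⟩ ⟨s, hs⟩
    obtain ⟨c, hc, h⟩ := exists_val_eq_smul_of_mk_eq_mk hN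
    have hsm := discr_smul_one_add_smul M.val 0 c
    rw [zero_smul, zero_add, ← h] at hsm
    exact (key N).mp hirr ⟨c * s, by rw [hsm, hs]; ring⟩
  · intro hD
    refine ⟨mk_ne_one_of_discr_ne_zero ?_, M, rfl, (key M).mpr hD⟩
    intro h
    exact hD (h ▸ IsSquare.zero)

end Splitting

section Orders

variable {F : Type*} [Field F] {K : Type*} [Field K] [Algebra F K]

theorem exists_eigenvalues (h2 : (2 : F) ≠ 0) [IsAlgClosed K] (M : GL (Fin 2) F)
    (hD : M.val.discr ≠ 0) :
    ∃ x y : K, x + y = algebraMap F K M.val.trace ∧ x * y = algebraMap F K M.val.det ∧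
      x ≠ 0 ∧ y ≠ 0 ∧ x ≠ y := by
  obtain ⟨s, hs⟩ := IsAlgClosed.exists_pow_nat_eq (algebraMap F K M.val.discr) two_pos
  have h2' : (2 : K) ≠ 0 := fun h ↦
    h2 ((algebraMap F K).injective (by rw [_root_.map_ofNat, h, map_zero]))
  have hs0 : s ≠ 0 := by
    rintro rfl
    rw [zero_pow two_ne_zero, eq_comm, map_eq_zero] at hs
    exact hD hs
  have hprod : (algebraMap F K M.val.trace + s) / 2 * ((algebraMap F K M.val.trace - s) / 2) =
      algebraMap F K M.val.det := by
    rw [discr_fin_two, map_sub, map_pow, map_mul, map_ofNat] at hs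
    field_simp
    linear_combination -hs
  have hd : algebraMap F K M.val.det ≠ 0 := (_root_.map_ne_zero _).mpr M.det_ne_zero
  refine ⟨_, _, ?_, hprod, left_ne_zero_of_mul (hprod ▸ hd), right_ne_zero_of_mul (hprod ▸ hd), ?_⟩
  · field_simp
    ring
  · intro h
    field_simp at h
    exact mul_ne_zero h2' hs0 (by linear_combination h)

theorem sq_eq_of_add_of_mul {x y : K} {t d : F} (ht : x + y = algebraMap F K t)
    (hd : x * y = algebraMap F K d) : x ^ 2 = algebraMap F K t * x - algebraMap F K d := by
  rw [← ht, ← hd]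
  ring

theorem trace_pow_eq {m : Matrix (Fin 2) (Fin 2) F} {x y : K}
    (ht : x + y = algebraMap F K m.trace) (hd : x * y = algebraMap F K m.det) (j : ℕ) :
    algebraMap F K (m ^ j).trace = x ^ j + y ^ j := by
  obtain ⟨a, b, hab, hroot⟩ := exists_pow_eq_add_smul K m j
  rw [hab, hroot x (sq_eq_of_add_of_mul ht hd),
    hroot y (sq_eq_of_add_of_mul (add_comm y x ▸ ht) (mul_comm y x ▸ hd))]
  simp only [trace_add, trace_smul, trace_one, Fintype.card_fin, smul_eq_mul, map_add, map_mul,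
    ← ht, Nat.cast_ofNat, _root_.map_ofNat]
  ring

theorem orderOf_mk_eq_orderOf_div {M : GL (Fin 2) F} {x y : K}
    (ht : x + y = algebraMap F K M.val.trace) (hd : x * y = algebraMap F K M.val.det)
    (hy : y ≠ 0) (hxy : x ≠ y) :
    orderOf (QuotientGroup.mk M : PGL2 F) = orderOf (x / y) := by
  rw [orderOf_eq_orderOf_iff]
  intro j
  obtain ⟨a, b, hab, hroot⟩ := exists_pow_eq_add_smul K M.val j
  have hD : M.val.discr ≠ 0 := by
    intro h
    rw [discr_fin_two] at h
    have h' := congrArg (algebraMap F K) h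
    rw [map_sub, map_pow, map_mul, map_ofNat, ← ht, ← hd, map_zero] at h'
    exact pow_ne_zero 2 (sub_ne_zero.mpr hxy) (by linear_combination h')
  have hns := mk_ne_one_of_discr_ne_zero hD
  rw [Ne, mk_eq_one_iff_mem_range_scalar] at hns
  rw [← QuotientGroup.mk_pow, mk_eq_one_iff_mem_range_scalar, Units.val_pow_eq_pow_val, div_pow,
    div_eq_one_iff_eq (pow_ne_zero j hy), hab, hroot x (sq_eq_of_add_of_mul ht hd),
    hroot y (sq_eq_of_add_of_mul (add_comm y x ▸ ht) (mul_comm y x ▸ hd)), add_right_inj,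
    mul_eq_mul_left_iff, or_iff_right hxy, map_eq_zero]
  constructor
  · rintro ⟨c, hc⟩
    by_contra hb
    refine hns ⟨b⁻¹ * (c - a), ?_⟩
    rw [← inv_smul_smul₀ hb M.val, ← sub_eq_of_eq_add' hc, scalar_apply, scalar_apply,
      ← smul_one_eq_diagonal, ← smul_one_eq_diagonal, ← sub_smul, smul_smul]
  · rintro rfl
    exact ⟨a, by rw [zero_smul, add_zero, scalar_apply, smul_one_eq_diagonal]⟩

/-- Two semisimple elements whose orders share a divisor `n` have powers of order `n` with the
same invariant `tr² / det`. -/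
theorem exists_pow_trace_sq_mul_det_eq (h2 : (2 : F) ≠ 0) {M N : GL (Fin 2) F}
    (hM : M.val.discr ≠ 0) (hN : N.val.discr ≠ 0)
    {n : ℕ} (hn : 0 < n) (hnM : n ∣ orderOf (QuotientGroup.mk M : PGL2 F))
    (hnN : n ∣ orderOf (QuotientGroup.mk N : PGL2 F))
    (hM0 : orderOf (QuotientGroup.mk M : PGL2 F) ≠ 0)
    (hN0 : orderOf (QuotientGroup.mk N : PGL2 F) ≠ 0) :
    ∃ i j : ℕ, orderOf ((QuotientGroup.mk M : PGL2 F) ^ i) = n ∧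
      orderOf ((QuotientGroup.mk N : PGL2 F) ^ j) = n ∧
      (M ^ i).val.trace ^ 2 * (N ^ j).val.det = (N ^ j).val.trace ^ 2 * (M ^ i).val.det := by
  let K := AlgebraicClosure F
  obtain ⟨x, y, ht, hd, hx, hy, hxy⟩ := exists_eigenvalues (K := K) h2 M hM
  obtain ⟨z, w, ht', hd', hz, hw, hzw⟩ := exists_eigenvalues (K := K) h2 N hN
  have hoM := orderOf_mk_eq_orderOf_div ht hd hy hxy
  have hoN := orderOf_mk_eq_orderOf_div ht' hd' hw hzw
  set i := orderOf (QuotientGroup.mk M : PGL2 F) / n with hi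
  set j := orderOf (QuotientGroup.mk N : PGL2 F) / n with hj
  have hiM : orderOf ((x / y) ^ i) = n := by
    rw [hi, hoM]
    exact orderOf_pow_orderOf_div (hoM ▸ hM0) (hoM ▸ hnM)
  have hjN : orderOf ((z / w) ^ j) = n := by
    rw [hj, hoN]
    exact orderOf_pow_orderOf_div (hoN ▸ hN0) (hoN ▸ hnN)
  have hprim : IsPrimitiveRoot ((x / y) ^ i) n := hiM ▸ IsPrimitiveRoot.orderOf _
  have : NeZero n := ⟨hn.ne'⟩
  obtain ⟨k, -, hk⟩ := hprim.eq_pow_of_pow_eq_one (hjN ▸ pow_orderOf_eq_one ((z / w) ^ j))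
  rw [← pow_mul] at hk
  refine ⟨i * k, j, ?_, orderOf_pow_orderOf_div hN0 hnN, ?_⟩
  · rw [← hjN, ← hk, orderOf_eq_orderOf_iff]
    intro l
    rw [← pow_mul, ← pow_mul, ← orderOf_dvd_iff_pow_eq_one, ← orderOf_dvd_iff_pow_eq_one, hoM]
  · apply (algebraMap F K).injective
    simp only [Units.val_pow_eq_pow_val, map_mul, map_pow, det_pow, ← hd, ← hd']
    rw [trace_pow_eq ht hd, trace_pow_eq ht' hd', mul_pow, mul_pow]
    rw [div_pow, div_pow, div_eq_div_iff (pow_ne_zero _ hy) (pow_ne_zero _ hw)] at hk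
    linear_combination (x ^ (i * k) * z ^ j - y ^ (i * k) * w ^ j) * hk

theorem orderOf_mk_dvd_of_discr_eq_zero (p : ℕ) [Fact p.Prime] [CharP F p] (h2 : (2 : F) ≠ 0)
    {M : GL (Fin 2) F} (hD : M.val.discr = 0) :
    orderOf (QuotientGroup.mk M : PGL2 F) ∣ p := by
  rw [orderOf_dvd_iff_pow_eq_one, ← QuotientGroup.mk_pow, mk_eq_one_iff_mem_range_scalar,
    Units.val_pow_eq_pow_val]
  have : NeZero (2 : F) := ⟨h2⟩
  have hsq := sub_scalar_sq_eq_discr (m := M.val)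
  rw [hD, zero_div, map_zero] at hsq
  set a := Matrix.scalar (Fin 2) (M.val.trace / 2) with ha
  have hcomm : Commute M.val a := (Matrix.scalar_commute _ (fun _ ↦ Commute.all _ _) _).symm
  have hp := sub_pow_char_of_commute (p := p) hcomm
  rw [pow_eq_zero_of_le (Fact.out : p.Prime).two_le hsq, eq_comm, sub_eq_zero] at hp
  exact ⟨(M.val.trace / 2) ^ p, by rw [hp, ha, map_pow]⟩

theorem not_dvd_orderOf_mk_of_discr_ne_zero (p : ℕ) [Fact p.Prime] [CharP F p]
    (h2 : (2 : F) ≠ 0) {M : GL (Fin 2) F} (hD : M.val.discr ≠ 0)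
    (h0 : orderOf (QuotientGroup.mk M : PGL2 F) ≠ 0) :
    ¬ p ∣ orderOf (QuotientGroup.mk M : PGL2 F) := by
  let K := AlgebraicClosure F
  obtain ⟨x, y, ht, hd, hx, hy, hxy⟩ := exists_eigenvalues (K := K) h2 M hD
  rw [orderOf_mk_eq_orderOf_div ht hd hy hxy] at h0 ⊢
  intro hp
  have : CharP K p := charP_of_injective_algebraMap (algebraMap F K).injective p
  have ho := orderOf_pow_orderOf_div h0 hp
  set ρ := (x / y) ^ (orderOf (x / y) / p)
  have h1 : ρ ^ (p ^ 1 * 1) = 1 := by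
    rw [pow_one, mul_one, ← ho, pow_orderOf_eq_one]
  rw [ExpChar.pow_prime_pow_mul_eq_one_iff p, pow_one] at h1
  rw [h1, orderOf_one] at ho
  exact (Fact.out : p.Prime).one_lt.ne ho

theorem coprime_orderOf_mk_of_discr (p : ℕ) [Fact p.Prime] [CharP F p] (h2 : (2 : F) ≠ 0)
    {M N : GL (Fin 2) F} (hM : M.val.discr = 0) (hN : N.val.discr ≠ 0)
    (h0 : orderOf (QuotientGroup.mk N : PGL2 F) ≠ 0) :
    Nat.Coprime (orderOf (QuotientGroup.mk M : PGL2 F)) (orderOf (QuotientGroup.mk N : PGL2 F)) :=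
  Nat.Coprime.coprime_dvd_left (orderOf_mk_dvd_of_discr_eq_zero p h2 hM)
    ((Nat.Prime.coprime_iff_not_dvd Fact.out).mpr (not_dvd_orderOf_mk_of_discr_ne_zero p h2 hN h0))

end Orders

section ConjPowers

variable {G : Type*} [Group G]

theorem inter_conjPowers_eq_one_iff (a b : G) :
    conjPowers a ∩ conjPowers b = {1} ↔ ∀ x ∈ conjPowers a, x ∈ conjPowers b → x = 1 := by
  have h1 : ∀ c : G, 1 ∈ conjPowers c := fun c ↦ ⟨1, 0, by simp⟩
  constructor
  · intro h x ha hb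
    exact h.le ⟨ha, hb⟩
  · intro h
    ext x
    refine ⟨fun hx ↦ h x hx.1 hx.2, ?_⟩
    rintro rfl
    exact ⟨h1 a, h1 b⟩

theorem pow_orderOf_eq_one_of_mem_conjPowers {a x : G} (h : x ∈ conjPowers a) :
    x ^ orderOf a = 1 := by
  obtain ⟨g, j, rfl⟩ := h
  rw [conj_pow, ← pow_mul, mul_comm, pow_mul, pow_orderOf_eq_one, one_pow, mul_one, mul_inv_cancel]

theorem eq_one_of_mem_conjPowers_of_coprime {a b x : G}
    (h : Nat.Coprime (orderOf a) (orderOf b)) (ha : x ∈ conjPowers a) (hb : x ∈ conjPowers b) :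
    x = 1 := by
  rw [← orderOf_eq_one_iff]
  exact Nat.eq_one_of_dvd_coprimes h
    (orderOf_dvd_of_pow_eq_one (pow_orderOf_eq_one_of_mem_conjPowers ha))
    (orderOf_dvd_of_pow_eq_one (pow_orderOf_eq_one_of_mem_conjPowers hb))

end ConjPowers

section Main

variable {F : Type*} [Field F]

theorem eq_one_of_mem_conjPowers_of_isSplit_of_isNonSplit (h2 : (2 : F) ≠ 0) {A B x : PGL2 F}
    (hA : IsSplit A) (hB : IsNonSplit B) (hxA : x ∈ conjPowers A) (hxB : x ∈ conjPowers B) :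
    x = 1 := by
  by_contra hx
  obtain ⟨M, rfl⟩ := QuotientGroup.mk_surjective A
  obtain ⟨N, rfl⟩ := QuotientGroup.mk_surjective B
  obtain ⟨X, rfl⟩ := QuotientGroup.mk_surjective x
  obtain ⟨g, i, hg⟩ := hxA
  obtain ⟨k, j, hk⟩ := hxB
  obtain ⟨c, hc, hcX⟩ := exists_discr_eq_sq_mul hg hx
  obtain ⟨d, hd, hdX⟩ := exists_discr_eq_sq_mul hk hx
  obtain ⟨-, s, hs⟩ := (isSplit_mk_iff h2 M).mp hA
  refine (isNonSplit_mk_iff h2 N).mp hB ⟨c * s / d, ?_⟩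
  field_simp
  linear_combination hcX - hdX + c ^ 2 * hs

theorem exists_eq_sq_mul_of_isSquare_iff [Finite F] {a b : F} (ha : a ≠ 0) (hb : b ≠ 0)
    (h : IsSquare a ↔ IsSquare b) : ∃ s : F, s ≠ 0 ∧ b = s ^ 2 * a := by
  classical
  have := Fintype.ofFinite F
  have hab : IsSquare (a * b) := by
    rw [← quadraticChar_one_iff_isSquare (mul_ne_zero ha hb), map_mul]
    by_cases hsq : IsSquare a
    · rw [(quadraticChar_one_iff_isSquare ha).mpr hsq,
        (quadraticChar_one_iff_isSquare hb).mpr (h.mp hsq), one_mul]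
    · rw [quadraticChar_neg_one_iff_not_isSquare.mpr hsq,
        quadraticChar_neg_one_iff_not_isSquare.mpr (mt h.mpr hsq)]
      norm_num
  obtain ⟨r, hr⟩ := hab
  refine ⟨r / a, div_ne_zero ?_ ha, ?_⟩
  · rintro rfl
    exact mul_ne_zero ha hb (by rw [hr, mul_zero])
  · field_simp
    linear_combination hr

theorem mem_conjPowers_pow_self {G : Type*} [Group G] (a : G) (j : ℕ) :
    a ^ j ∈ conjPowers a := ⟨1, j, by simp⟩

/-- If the discriminants have the same quadratic character and the orders are not coprime, the
conjugates of powers of the two elements meet non-trivially. -/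
theorem exists_ne_one_mem_conjPowers [Finite F] (h2 : (2 : F) ≠ 0) {M N : GL (Fin 2) F}
    (hM : M.val.discr ≠ 0) (hN : N.val.discr ≠ 0)
    (hsq : IsSquare M.val.discr ↔ IsSquare N.val.discr)
    (hcop : ¬ Nat.Coprime (orderOf (QuotientGroup.mk M : PGL2 F))
      (orderOf (QuotientGroup.mk N : PGL2 F))) :
    ∃ x ∈ conjPowers (QuotientGroup.mk M : PGL2 F),
      x ∈ conjPowers (QuotientGroup.mk N : PGL2 F) ∧ x ≠ 1 := by
  have hM0 := (orderOf_pos (QuotientGroup.mk M : PGL2 F)).ne'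
  have hN0 := (orderOf_pos (QuotientGroup.mk N : PGL2 F)).ne'
  obtain ⟨i, j, hi, hj, hτ⟩ := exists_pow_trace_sq_mul_det_eq h2 hM hN
    (Nat.gcd_pos_of_pos_left _ (Nat.pos_of_ne_zero hM0)) (Nat.gcd_dvd_left _ _)
    (Nat.gcd_dvd_right _ _) hM0 hN0
  have hMi : (QuotientGroup.mk M : PGL2 F) ^ i ≠ 1 := fun h ↦ hcop (by
    rw [Nat.Coprime, ← hi, h, orderOf_one])
  have hNj : (QuotientGroup.mk N : PGL2 F) ^ j ≠ 1 := fun h ↦ hcop (by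
    rw [Nat.Coprime, ← hj, h, orderOf_one])
  obtain ⟨s, hs, hsD⟩ := exists_eq_sq_mul_of_isSquare_iff hM hN hsq
  obtain ⟨c, hc, hcD⟩ := exists_discr_pow_eq_sq_mul hMi
  obtain ⟨d, hd, hdD⟩ := exists_discr_pow_eq_sq_mul hNj
  obtain ⟨g, hg⟩ := isConj_mk_of_discr h2 (M := M ^ i) (N := N ^ j) hMi hNj hτ
    (s := d * s / c) (div_ne_zero (mul_ne_zero hd hs) hc) (by
      rw [hcD, hdD, hsD]
      field_simp)
  exact ⟨(QuotientGroup.mk N : PGL2 F) ^ j, ⟨g, i, hg⟩, mem_conjPowers_pow_self _ _, hNj⟩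

theorem gcd_orderOf_eq_two [Finite F] (h2 : (2 : F) ≠ 0) {M N : GL (Fin 2) F}
    (hM : M.val.discr ≠ 0) (hN : N.val.discr ≠ 0)
    (hsq : ¬ (IsSquare M.val.discr ↔ IsSquare N.val.discr))
    (hcop : ¬ Nat.Coprime (orderOf (QuotientGroup.mk M : PGL2 F))
      (orderOf (QuotientGroup.mk N : PGL2 F))) :
    Nat.gcd (orderOf (QuotientGroup.mk M : PGL2 F))
      (orderOf (QuotientGroup.mk N : PGL2 F)) = 2 := by
  have hM0 := (orderOf_pos (QuotientGroup.mk M : PGL2 F)).ne'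
  have hN0 := (orderOf_pos (QuotientGroup.mk N : PGL2 F)).ne'
  obtain ⟨i, j, hi, hj, hτ⟩ := exists_pow_trace_sq_mul_det_eq h2 hM hN
    (Nat.gcd_pos_of_pos_left _ (Nat.pos_of_ne_zero hM0)) (Nat.gcd_dvd_left _ _)
    (Nat.gcd_dvd_right _ _) hM0 hN0
  have hMi : (QuotientGroup.mk M : PGL2 F) ^ i ≠ 1 := fun h ↦ hcop (by
    rw [Nat.Coprime, ← hi, h, orderOf_one])
  have hNj : (QuotientGroup.mk N : PGL2 F) ^ j ≠ 1 := fun h ↦ hcop (by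
    rw [Nat.Coprime, ← hj, h, orderOf_one])
  obtain ⟨c, hc, hcD⟩ := exists_discr_pow_eq_sq_mul hMi
  obtain ⟨d, hd, hdD⟩ := exists_discr_pow_eq_sq_mul hNj
  have hdM : (M ^ i).val.det ≠ 0 := (M ^ i).det_ne_zero
  have hdN : (N ^ j).val.det ≠ 0 := (N ^ j).det_ne_zero
  have htr : (M ^ i).val.trace = 0 := by
    by_contra ht
    have ht' : (N ^ j).val.trace ≠ 0 := by
      intro h
      rw [h, zero_pow two_ne_zero, zero_mul] at hτ
      exact mul_ne_zero (pow_ne_zero 2 ht) hdN hτ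
    have hDD : ((M ^ i).val.trace * d) ^ 2 * N.val.discr =
        ((N ^ j).val.trace * c) ^ 2 * M.val.discr := by
      rw [mul_pow, mul_assoc, ← hdD, mul_pow, mul_assoc, ← hcD, discr_fin_two, discr_fin_two]
      linear_combination -4 * hτ
    refine hsq ⟨?_, ?_⟩
    · rintro ⟨r, hr⟩
      refine ⟨(N ^ j).val.trace * c * r / ((M ^ i).val.trace * d), ?_⟩
      field_simp
      linear_combination hDD + ((N ^ j).val.trace * c) ^ 2 * hr
    · rintro ⟨r, hr⟩
      refine ⟨(M ^ i).val.trace * d * r / ((N ^ j).val.trace * c), ?_⟩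
      field_simp
      linear_combination -hDD + ((M ^ i).val.trace * d) ^ 2 * hr
  have hsq1 : ((QuotientGroup.mk M : PGL2 F) ^ i) ^ 2 = 1 := by
    rw [← QuotientGroup.mk_pow, ← QuotientGroup.mk_pow, mk_eq_one_iff_mem_range_scalar]
    refine ⟨-(M ^ i).val.det, ?_⟩
    rw [Units.val_pow_eq_pow_val (M ^ i), sq_eq_trace_smul_sub_det, htr, zero_smul, zero_sub,
      scalar_apply, ← smul_one_eq_diagonal, neg_smul]
  rw [← hi]
  exact orderOf_eq_prime hsq1 hMi

theorem inter_conjPowers_eq_one_iff_of_charP [Finite F] (p : ℕ) [Fact p.Prime] [CharP F p]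
    (h2 : (2 : F) ≠ 0) (A B : PGL2 F) :
    conjPowers A ∩ conjPowers B = {1} ↔
      (Nat.Coprime (orderOf A) (orderOf B) ∨
        (IsSplit A ∧ IsNonSplit B ∧ Nat.gcd (orderOf A) (orderOf B) = 2) ∨
        (IsNonSplit A ∧ IsSplit B ∧ Nat.gcd (orderOf A) (orderOf B) = 2)) := by
  rw [inter_conjPowers_eq_one_iff]
  constructor
  · intro h
    rw [or_iff_not_imp_left]
    intro hcop
    have hA1 : A ≠ 1 := by
      rintro rfl
      exact hcop (by simp)
    have hB1 : B ≠ 1 := by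
      rintro rfl
      exact hcop (by simp)
    obtain ⟨M, rfl⟩ := QuotientGroup.mk_surjective A
    obtain ⟨N, rfl⟩ := QuotientGroup.mk_surjective B
    have hM0 := (orderOf_pos (QuotientGroup.mk M : PGL2 F)).ne'
    have hN0 := (orderOf_pos (QuotientGroup.mk N : PGL2 F)).ne'
    by_cases hM : M.val.discr = 0
    · by_cases hN : N.val.discr = 0
      · obtain ⟨g, hg⟩ := isConj_mk_of_discr h2 hA1 hB1 (by
          rw [discr_fin_two] at hM hN
          linear_combination N.val.det * hM - M.val.det * hN) one_ne_zero
          (by rw [hM, hN, mul_zero])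
        refine absurd (h _ ⟨g, 1, by rw [hg, pow_one]⟩ ?_) hB1
        simpa using mem_conjPowers_pow_self (QuotientGroup.mk N : PGL2 F) 1
      · exact absurd (coprime_orderOf_mk_of_discr p h2 hM hN hN0) hcop
    · by_cases hN : N.val.discr = 0
      · exact absurd (coprime_orderOf_mk_of_discr p h2 hN hM hM0).symm hcop
      · have hsq : ¬ (IsSquare M.val.discr ↔ IsSquare N.val.discr) := by
          intro hsq
          obtain ⟨x, hxM, hxN, hx⟩ := exists_ne_one_mem_conjPowers h2 hM hN hsq hcop
          exact hx (h x hxM hxN)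
        have hgcd := gcd_orderOf_eq_two h2 hM hN hsq hcop
        by_cases hMs : IsSquare M.val.discr
        · exact Or.inl ⟨(isSplit_mk_iff h2 M).mpr ⟨hM, hMs⟩,
            (isNonSplit_mk_iff h2 N).mpr fun hNs ↦ hsq (iff_of_true hMs hNs), hgcd⟩
        · exact Or.inr ⟨(isNonSplit_mk_iff h2 M).mpr hMs, (isSplit_mk_iff h2 N).mpr
            ⟨hN, by_contra fun hNs ↦ hsq (iff_of_false hMs hNs)⟩, hgcd⟩
  · rintro (hcop | ⟨hA, hB, -⟩ | ⟨hA, hB, -⟩) x hxA hxB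
    · exact eq_one_of_mem_conjPowers_of_coprime hcop hxA hxB
    · exact eq_one_of_mem_conjPowers_of_isSplit_of_isNonSplit h2 hA hB hxA hxB
    · exact eq_one_of_mem_conjPowers_of_isSplit_of_isNonSplit h2 hB hA hxB hxA

end Main

/-- Let `G₁ = PGL₂(q)`, `q = p ^ e` with `p` an odd prime, and
`A₁, A₂ ∈ G₁`.  Then `Σ(A₁) ∩ Σ(A₂) = {1}` iff the orders of `A₁` and `A₂` are coprime, or
one of them is split, the other non-split, and the gcd of their orders is `2`. -/
theorem sigma_inter_trivial_iff_PGL2 (p e : ℕ) (hp : p.Prime) (hodd : Odd p) (he : 0 < e)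
    (F : Type*) [Field F] [Fintype F] (hF : Fintype.card F = p ^ e)
    (A₁ A₂ : PGL2 F) :
    conjPowers A₁ ∩ conjPowers A₂ = {1} ↔
      (Nat.Coprime (orderOf A₁) (orderOf A₂) ∨
        (IsSplit A₁ ∧ IsNonSplit A₂ ∧ Nat.gcd (orderOf A₁) (orderOf A₂) = 2) ∨
        (IsNonSplit A₁ ∧ IsSplit A₂ ∧ Nat.gcd (orderOf A₁) (orderOf A₂) = 2)) := by
  have : Fact p.Prime := ⟨hp⟩
  have : CharP F p := charP_of_card_eq_prime_pow hF
  have h2 : (2 : F) ≠ 0 := by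
    have h := Ring.two_ne_zero (R := F)
    rw [ringChar.eq F p] at h
    exact h (by rintro rfl; exact absurd hodd (by decide))
  exact inter_conjPowers_eq_one_iff_of_charP p h2 A₁ A₂
end

section
/- Let G = PSL₂(q) where 5 < q = p^e for a prime p and a positive integer e, and suppose that p = 2, or e is odd, or q = 9. If G admits an unmixed Beauville structure of type ((r₁,s₁,t₁),(r₂,s₂,t₂)), then r₁s₁t₁ is coprime to r₂s₂t₂. -/
open Matrix

/-- `Σ(a, b, c)`: the union of the conjugacy classes of all powers of `a`, of `b`, and
of `c`. -/
def sigma3 {G : Type*} [Group G] (a b c : G) : Set G :=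
  conjPowers a ∪ conjPowers b ∪ conjPowers c

/-- An unmixed Beauville structure for a group `G`: two triples, each with product `1` and
generating `G`, whose `Σ`-sets intersect trivially. -/
def IsUnmixedBeauville {G : Type*} [Group G] (a₁ b₁ c₁ a₂ b₂ c₂ : G) : Prop :=
  a₁ * b₁ * c₁ = 1 ∧ a₂ * b₂ * c₂ = 1 ∧
  Subgroup.closure ({a₁, b₁} : Set G) = ⊤ ∧ Subgroup.closure ({a₂, b₂} : Set G) = ⊤ ∧
  sigma3 a₁ b₁ c₁ ∩ sigma3 a₂ b₂ c₂ = {1}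

/-- `G` admits an unmixed Beauville structure of type `((r₁,s₁,t₁),(r₂,s₂,t₂))`. -/
def HasBeauvilleOfType (G : Type*) [Group G] (r₁ s₁ t₁ r₂ s₂ t₂ : ℕ) : Prop :=
  ∃ a₁ b₁ c₁ a₂ b₂ c₂ : G, IsUnmixedBeauville a₁ b₁ c₁ a₂ b₂ c₂ ∧
    orderOf a₁ = r₁ ∧ orderOf b₁ = s₁ ∧ orderOf c₁ = t₁ ∧
    orderOf a₂ = r₂ ∧ orderOf b₂ = s₂ ∧ orderOf c₂ = t₂

namespace Matrix.SpecialLinearGroup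

variable {F : Type*} [Field F]

theorem det_fin_two_eq_one (A : SpecialLinearGroup (Fin 2) F) :
    A 0 0 * A 1 1 - A 0 1 * A 1 0 = 1 := by
  have h := A.det_coe
  rwa [Matrix.det_fin_two] at h

theorem mem_center_fin_two {A : SpecialLinearGroup (Fin 2) F} :
    A ∈ Subgroup.center (SpecialLinearGroup (Fin 2) F) ↔
      A 0 1 = 0 ∧ A 1 0 = 0 ∧ A 0 0 = A 1 1 := by
  rw [mem_center_iff]
  constructor
  · rintro ⟨r, -, hr⟩
    simp [← hr]
  · rintro ⟨h01, h10, h⟩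
    refine ⟨A 0 0, ?_, ?_⟩
    · have := A.det_fin_two_eq_one
      rw [h01, ← h] at this
      rw [Fintype.card_fin]
      linear_combination this
    · ext i j
      fin_cases i <;> fin_cases j <;> simp [h01, h10, h]

/-- The quadratic form `v ↦ det (v, A v)` evaluated at `v = (x, y)`. -/
def cyclicForm (A : SpecialLinearGroup (Fin 2) F) (x y : F) : F :=
  A 1 0 * x ^ 2 + (A 1 1 - A 0 0) * x * y - A 0 1 * y ^ 2

/-- The trace of an element of `SL(2, F)`. -/
def tr (A : SpecialLinearGroup (Fin 2) F) : F := A 0 0 + A 1 1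

theorem cyclicForm_smul (A : SpecialLinearGroup (Fin 2) F) (m x y : F) :
    A.cyclicForm (m * x) (m * y) = m ^ 2 * A.cyclicForm x y := by
  simp only [cyclicForm]
  ring

theorem exists_cyclicForm_ne_zero {A : SpecialLinearGroup (Fin 2) F}
    (hA : A ∉ Subgroup.center (SpecialLinearGroup (Fin 2) F)) :
    ∃ x y, A.cyclicForm x y ≠ 0 := by
  contrapose! hA
  have h1 := hA 1 0
  have h2 := hA 0 1
  have h3 := hA 1 1
  simp only [cyclicForm] at h1 h2 h3
  refine mem_center_fin_two.mpr ⟨by linear_combination -h2, by linear_combination h1, ?_⟩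
  linear_combination h1 + h2 - h3

theorem not_mem_center_of_cyclicForm_ne_zero {A : SpecialLinearGroup (Fin 2) F} {x y : F}
    (h : A.cyclicForm x y ≠ 0) : A ∉ Subgroup.center (SpecialLinearGroup (Fin 2) F) := by
  intro hA
  obtain ⟨h1, h2, h3⟩ := mem_center_fin_two.mp hA
  exact h (by simp [cyclicForm, h1, h2, h3])

theorem isConj_of_cyclicForm_eq {A B : SpecialLinearGroup (Fin 2) F} (ht : A.tr = B.tr)
    {x y z w : F} (h0 : A.cyclicForm x y ≠ 0) (h : A.cyclicForm x y = B.cyclicForm z w) :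
    IsConj A B := by
  have key : ∀ (s t : F), s ≠ 0 → ∃ C : SpecialLinearGroup (Fin 2) F,
      ∀ (M : SpecialLinearGroup (Fin 2) F) (x y : F), M.tr = t → M.cyclicForm x y = s →
        IsConj C M := by
    intro s t hs
    obtain ⟨C, hC⟩ : ∃ C : SpecialLinearGroup (Fin 2) F,
        (C : Matrix (Fin 2) (Fin 2) F) = !![0, -s⁻¹; s, t] :=
      ⟨⟨_, by simp [Matrix.det_fin_two, hs]⟩, rfl⟩
    refine ⟨C, fun M x y hM hf => ?_⟩
    simp only [cyclicForm] at hf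
    simp only [tr] at hM
    have hd := M.det_fin_two_eq_one
    obtain ⟨P, hP⟩ : ∃ P : SpecialLinearGroup (Fin 2) F, (P : Matrix (Fin 2) (Fin 2) F) =
        !![x, s⁻¹ * (M 0 0 * x + M 0 1 * y); y, s⁻¹ * (M 1 0 * x + M 1 1 * y)] := by
      refine ⟨⟨_, ?_⟩, rfl⟩
      rw [Matrix.det_fin_two_of]
      field_simp
      linear_combination hf
    refine isConj_iff.mpr ⟨P, mul_inv_eq_iff_eq_mul.mpr ?_⟩
    ext i j
    rw [coe_mul, coe_mul, hP, hC]
    fin_cases i <;> fin_cases j <;> simp [Matrix.mul_apply, Fin.sum_univ_two] <;> field_simp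
    · rw [← hM]
      linear_combination x * hd
    · rw [← hM]
      linear_combination y * hd
  obtain ⟨C, hC⟩ := key _ _ h0
  exact (hC A x y rfl rfl).symm.trans (hC B z w (by rw [ht]) h.symm)

theorem exists_cyclicForm_eq_one [Fintype F] {A : SpecialLinearGroup (Fin 2) F}
    (hA : A ∉ Subgroup.center (SpecialLinearGroup (Fin 2) F))
    (h : (2 : F) = 0 ∨ A.tr ^ 2 ≠ 4) : ∃ x y, A.cyclicForm x y = 1 := by
  have hd := A.det_fin_two_eq_one
  by_cases h2 : (2 : F) = 0
  · have hsq : ∀ a : F, ∃ r, a = r * r := by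
      intro a
      have : ringChar F = 2 := by
        have : CharP F 2 := CharTwo.of_one_ne_zero_of_two_eq_zero one_ne_zero h2
        exact ringChar.eq F 2 ▸ rfl
      exact FiniteField.isSquare_of_char_two this a
    obtain ⟨x, y, hxy⟩ := exists_cyclicForm_ne_zero hA
    obtain ⟨r, hr⟩ := hsq (A.cyclicForm x y)
    have hr0 : r ≠ 0 := by
      rintro rfl
      exact hxy (by simpa using hr)
    refine ⟨r⁻¹ * x, r⁻¹ * y, ?_⟩
    rw [cyclicForm_smul, hr]
    field_simp
  · have ht : A.tr ^ 2 ≠ 4 := h.resolve_left h2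
    simp only [tr] at ht
    simp only [cyclicForm]
    by_cases hc : A 1 0 = 0
    · have hne : A 1 1 - A 0 0 ≠ 0 := by
        intro h0
        apply ht
        rw [hc] at hd
        linear_combination (A 1 1 - A 0 0) * h0 + 4 * hd
      refine ⟨(1 + A 0 1) / (A 1 1 - A 0 0), 1, ?_⟩
      rw [hc]
      field_simp
      ring
    · have hD : (A 0 0 + A 1 1) ^ 2 - 4 ≠ 0 := sub_ne_zero.mpr ht
      set D := (A 0 0 + A 1 1) ^ 2 - 4 with hDdef
      have h4 : (4 : F) ≠ 0 := by
        have : (4 : F) = 2 * 2 := by norm_num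
        rw [this]
        exact mul_ne_zero h2 h2
      have hcard : Fintype.card F % 2 = 1 := by
        apply FiniteField.odd_card_of_char_ne_two
        intro hr
        apply h2
        have := ringChar.Nat.cast_ringChar (R := F)
        rw [hr] at this
        exact_mod_cast this
      have hdeg : ∀ a c : F, a ≠ 0 →
          (Polynomial.C a * Polynomial.X ^ 2 + Polynomial.C 0 * Polynomial.X +
            Polynomial.C c).degree = 2 :=
        fun a c ha => Polynomial.degree_quadratic ha
      obtain ⟨u, y, huy⟩ := FiniteField.exists_root_sum_quadratic
        (hdeg 1 (-A 1 0) one_ne_zero) (hdeg (-(D / 4)) 0 (by simp [hD, h4])) hcard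
      simp only [Polynomial.eval_add, Polynomial.eval_mul, Polynomial.eval_C, Polynomial.eval_pow,
        Polynomial.eval_X] at huy
      refine ⟨(u - (A 1 1 - A 0 0) / 2 * y) / A 1 0, y, ?_⟩
      have h22 : (2 : F) ≠ 0 := h2
      rw [hDdef] at huy
      field_simp at huy ⊢
      linear_combination huy + 4 * y ^ 2 * hd

theorem isConj_of_tr_eq [Fintype F] {A B : SpecialLinearGroup (Fin 2) F}
    (hA : A ∉ Subgroup.center (SpecialLinearGroup (Fin 2) F))
    (hB : B ∉ Subgroup.center (SpecialLinearGroup (Fin 2) F))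
    (ht : A.tr = B.tr) (h : (2 : F) = 0 ∨ A.tr ^ 2 ≠ 4) : IsConj A B := by
  obtain ⟨x, y, hxy⟩ := exists_cyclicForm_eq_one hA h
  obtain ⟨z, w, hzw⟩ := exists_cyclicForm_eq_one hB (ht ▸ h)
  exact isConj_of_cyclicForm_eq ht (by rw [hxy]; exact one_ne_zero) (hxy.trans hzw.symm)

theorem exists_eigenvalue (K : Type*) [Field K] [Algebra F K] [IsAlgClosed K]
    (A : SpecialLinearGroup (Fin 2) F) :
    ∃ ζ : K, ζ ≠ 0 ∧ ∀ n : ℕ, algebraMap F K (A ^ n).tr = ζ ^ n + (ζ⁻¹) ^ n := by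
  obtain ⟨ζ, hζ⟩ := IsAlgClosed.exists_root
    (Polynomial.C (1 : K) * Polynomial.X ^ 2 + Polynomial.C (-(algebraMap F K A.tr)) * Polynomial.X
      + Polynomial.C 1) (by rw [Polynomial.degree_quadratic one_ne_zero]; decide)
  simp only [Polynomial.IsRoot, Polynomial.eval_add, Polynomial.eval_mul, Polynomial.eval_C,
    Polynomial.eval_pow, Polynomial.eval_X] at hζ
  have hζ0 : ζ ≠ 0 := by
    rintro rfl
    simp at hζ
  have ht : algebraMap F K A.tr = ζ + ζ⁻¹ := by
    field_simp
    linear_combination -hζ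
  have hrec : ∀ n : ℕ, (A ^ (n + 2)).tr = A.tr * (A ^ (n + 1)).tr - (A ^ n).tr := by
    intro n
    have hd := A.det_fin_two_eq_one
    have h1 : A ^ (n + 1) = A * A ^ n := pow_succ' A n
    have h2 : A ^ (n + 2) = A * (A * A ^ n) := by rw [← h1, ← pow_succ']
    simp only [h1, h2, tr, coe_mul, Matrix.mul_apply, Fin.sum_univ_two]
    linear_combination -((A ^ n) 0 0 + (A ^ n) 1 1) * hd
  refine ⟨ζ, hζ0, fun n => ?_⟩
  induction n using Nat.twoStepInduction with
  | zero => simp [tr]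
  | one => simp [ht]
  | more n ih1 ih2 =>
    rw [hrec, map_sub, map_mul, ih1, ih2, ht]
    linear_combination (ζ⁻¹ ^ n + ζ ^ n) * mul_inv_cancel₀ hζ0

/-- A power of an element of `SL(2, F)` being scalar forces the eigenvalue equation. -/
theorem eigenvalue_pow_of_mem_center {K : Type*} [Field K] [Algebra F K]
    {A : SpecialLinearGroup (Fin 2) F} {ζ : K} (hζ0 : ζ ≠ 0)
    (hζ : ∀ n : ℕ, algebraMap F K (A ^ n).tr = ζ ^ n + (ζ⁻¹) ^ n) {n : ℕ}
    (hn : A ^ n ∈ Subgroup.center (SpecialLinearGroup (Fin 2) F)) :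
    ζ ^ n = algebraMap F K ((A ^ n) 0 0) := by
  obtain ⟨h1, h2, h3⟩ := mem_center_fin_two.mp hn
  have hd := (A ^ n).det_fin_two_eq_one
  rw [← h3, h1] at hd
  have h := hζ n
  rw [tr, ← h3, map_add] at h
  have hd' := congrArg (algebraMap F K) hd
  simp only [map_mul, map_sub, map_one, map_zero] at hd'
  have hz : ζ ^ n ≠ 0 := pow_ne_zero _ hζ0
  rw [inv_pow] at h
  field_simp at h
  rw [← sub_eq_zero, ← sq_eq_zero_iff (a := _ - _)]
  linear_combination -h + hd'

theorem coe_pow_of_tr_eq_two {A : SpecialLinearGroup (Fin 2) F} (h : A.tr = 2) (n : ℕ) :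
    ((A ^ n : SpecialLinearGroup (Fin 2) F) : Matrix (Fin 2) (Fin 2) F) =
      1 + (n : F) • ((A : Matrix (Fin 2) (Fin 2) F) - 1) := by
  have hd := A.det_fin_two_eq_one
  rw [tr] at h
  induction n with
  | zero => simp
  | succ n ih =>
    rw [pow_succ, coe_mul, ih]
    ext i j
    fin_cases i <;> fin_cases j <;> simp [Matrix.mul_apply, Fin.sum_univ_two]
    · linear_combination (n : F) * (A 0 0 * h - hd)
    · linear_combination (n : F) * A 0 1 * h
    · linear_combination (n : F) * A 1 0 * h
    · linear_combination (n : F) * (A 1 1 * h - hd)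

theorem tr_pow_of_tr_eq_two {A : SpecialLinearGroup (Fin 2) F} (h : A.tr = 2) (n : ℕ) :
    (A ^ n).tr = 2 := by
  rw [tr] at h ⊢
  rw [coe_pow_of_tr_eq_two h]
  simp
  linear_combination (n : F) * h

theorem cyclicForm_pow_of_tr_eq_two {A : SpecialLinearGroup (Fin 2) F} (h : A.tr = 2) (n : ℕ)
    (x y : F) : (A ^ n).cyclicForm x y = n * A.cyclicForm x y := by
  rw [cyclicForm, coe_pow_of_tr_eq_two h]
  simp [cyclicForm]
  ring

theorem tr_sq_of_mem_center {A : SpecialLinearGroup (Fin 2) F}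
    (h : A ∈ Subgroup.center (SpecialLinearGroup (Fin 2) F)) : A.tr ^ 2 = 4 := by
  obtain ⟨h1, h2, h3⟩ := mem_center_fin_two.mp h
  have hd := A.det_fin_two_eq_one
  rw [tr]
  rw [h1, ← h3] at hd
  rw [← h3]
  linear_combination 4 * hd

theorem tr_eq_zero_of_sq_mem_center {A : SpecialLinearGroup (Fin 2) F}
    (hA : A ∉ Subgroup.center (SpecialLinearGroup (Fin 2) F))
    (h : A ^ 2 ∈ Subgroup.center (SpecialLinearGroup (Fin 2) F)) : A.tr = 0 := by
  by_contra ht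
  apply hA
  obtain ⟨h1, h2, h3⟩ := mem_center_fin_two.mp h
  simp only [pow_two, coe_mul, Matrix.mul_apply, Fin.sum_univ_two] at h1 h2 h3
  refine mem_center_fin_two.mpr ⟨mul_left_cancel₀ ht ?_, mul_left_cancel₀ ht ?_,
    mul_left_cancel₀ ht ?_⟩ <;> rw [tr]
  · linear_combination h1
  · linear_combination h2
  · linear_combination h3

theorem neg_mem_center_iff {A : SpecialLinearGroup (Fin 2) F} :
    -A ∈ Subgroup.center (SpecialLinearGroup (Fin 2) F) ↔
      A ∈ Subgroup.center (SpecialLinearGroup (Fin 2) F) := by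
  simp [mem_center_fin_two]

@[simp]
theorem tr_neg (A : SpecialLinearGroup (Fin 2) F) : (-A).tr = -A.tr := by
  simp [tr]
  ring

@[simp]
theorem cyclicForm_neg (A : SpecialLinearGroup (Fin 2) F) (x y : F) :
    (-A).cyclicForm x y = -A.cyclicForm x y := by
  simp [cyclicForm]
  ring

end Matrix.SpecialLinearGroup

namespace PSL2

open Matrix.SpecialLinearGroup

variable {F : Type*} [Field F]

theorem mk_neg (A : SpecialLinearGroup (Fin 2) F) :
    ((-A : SpecialLinearGroup (Fin 2) F) : PSL2 F) = A := by
  rw [QuotientGroup.eq]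
  have : (-A)⁻¹ * A = -1 := by
    rw [inv_mul_eq_iff_eq_mul, neg_mul_neg, mul_one]
  rw [this, neg_mem_center_iff]
  exact one_mem _

theorem mk_isConj {A B : SpecialLinearGroup (Fin 2) F} (h : IsConj A B) :
    IsConj (A : PSL2 F) (B : PSL2 F) :=
  (QuotientGroup.mk' (Subgroup.center (SpecialLinearGroup (Fin 2) F))).map_isConj h

theorem mk_pow_eq_one_iff {A : SpecialLinearGroup (Fin 2) F} {n : ℕ} :
    (A : PSL2 F) ^ n = 1 ↔ A ^ n ∈ Subgroup.center (SpecialLinearGroup (Fin 2) F) := by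
  rw [← QuotientGroup.eq_one_iff, QuotientGroup.mk_pow]

theorem not_mem_center_of_orderOf {A : SpecialLinearGroup (Fin 2) F} {n : ℕ} (hn : n ≠ 1)
    (h : orderOf (A : PSL2 F) = n) : A ∉ Subgroup.center (SpecialLinearGroup (Fin 2) F) := by
  rw [← QuotientGroup.eq_one_iff, ← orderOf_eq_one_iff, h]
  exact hn

theorem isConj_of_orderOf_eq_two [Fintype F] {x y : PSL2 F} (hx : orderOf x = 2)
    (hy : orderOf y = 2) : IsConj x y := by
  obtain ⟨A, rfl⟩ := QuotientGroup.mk_surjective x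
  obtain ⟨B, rfl⟩ := QuotientGroup.mk_surjective y
  have hA := not_mem_center_of_orderOf (by decide) hx
  have hB := not_mem_center_of_orderOf (by decide) hy
  have hA0 := tr_eq_zero_of_sq_mem_center hA (mk_pow_eq_one_iff.mp (orderOf_dvd_iff_pow_eq_one.mp hx.dvd))
  have hB0 := tr_eq_zero_of_sq_mem_center hB (mk_pow_eq_one_iff.mp (orderOf_dvd_iff_pow_eq_one.mp hy.dvd))
  refine mk_isConj (isConj_of_tr_eq hA hB (hA0.trans hB0.symm) ?_)
  by_cases h2 : (2 : F) = 0
  · exact Or.inl h2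
  · right
    rw [hA0]
    intro h
    have : (2 : F) * 2 = 0 := by linear_combination -h
    simp [h2] at this

theorem exists_lift_of_orderOf_odd {x : PSL2 F} {n : ℕ} (hn : Odd n) (hx : orderOf x = n) :
    ∃ A : SpecialLinearGroup (Fin 2) F, (A : PSL2 F) = x ∧ (A ^ n) 0 0 = 1 ∧
      A ^ n ∈ Subgroup.center (SpecialLinearGroup (Fin 2) F) := by
  obtain ⟨A, rfl⟩ := QuotientGroup.mk_surjective x
  have hc : A ^ n ∈ Subgroup.center (SpecialLinearGroup (Fin 2) F) :=
    mk_pow_eq_one_iff.mp (orderOf_dvd_iff_pow_eq_one.mp hx.dvd)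
  obtain ⟨h1, h2, h3⟩ := mem_center_fin_two.mp hc
  have hd := (A ^ n).det_fin_two_eq_one
  rw [h1, ← h3, zero_mul, sub_zero, mul_self_eq_one_iff] at hd
  rcases hd with hd | hd
  · exact ⟨A, rfl, hd, hc⟩
  · refine ⟨-A, mk_neg A, ?_, ?_⟩
    · rw [hn.neg_pow, coe_neg, Matrix.neg_apply, hd, neg_neg]
    · rwa [hn.neg_pow, neg_mem_center_iff]

theorem exists_isConj_pow_of_orderOf_eq [Fintype F] {ℓ : ℕ} (hℓ : ℓ.Prime) (hodd : Odd ℓ)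
    (hF : (ℓ : F) ≠ 0) {x y : PSL2 F} (hx : orderOf x = ℓ) (hy : orderOf y = ℓ) :
    ∃ k : ℕ, IsConj x (y ^ k) := by
  have : Fact ℓ.Prime := ⟨hℓ⟩
  have key : ∀ z : PSL2 F, orderOf z = ℓ → ∃ A : SpecialLinearGroup (Fin 2) F, (A : PSL2 F) = z ∧
      A.tr ^ 2 ≠ 4 ∧ A ∉ Subgroup.center (SpecialLinearGroup (Fin 2) F) ∧
      ∃ ζ : AlgebraicClosure F, IsPrimitiveRoot ζ ℓ ∧
        ∀ n : ℕ, algebraMap F (AlgebraicClosure F) (A ^ n).tr = ζ ^ n + (ζ⁻¹) ^ n := by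
    intro z hz
    obtain ⟨A, rfl, h1, hc⟩ := exists_lift_of_orderOf_odd hodd hz
    have hA := not_mem_center_of_orderOf hℓ.ne_one hz
    obtain ⟨ζ, hζ0, hζ⟩ := exists_eigenvalue (AlgebraicClosure F) A
    have hpow : ζ ^ ℓ = 1 := by
      rw [eigenvalue_pow_of_mem_center hζ0 hζ hc, h1, map_one]
    have hne : ζ ≠ 1 := by
      rintro rfl
      have ht : A.tr = 2 := by
        apply (algebraMap F (AlgebraicClosure F)).injective
        have := hζ 1
        rw [pow_one] at this
        rw [this, map_ofNat]
        norm_num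
      apply hA
      obtain ⟨h01, h10, h00⟩ := mem_center_fin_two.mp hc
      rw [coe_pow_of_tr_eq_two ht] at h01 h10 h00
      simp [hF] at h01 h10 h00
      exact mem_center_fin_two.mpr ⟨h01, h10, h00⟩
    have hprim : IsPrimitiveRoot ζ ℓ := by
      rw [← orderOf_eq_prime hpow hne]
      exact IsPrimitiveRoot.orderOf ζ
    refine ⟨A, rfl, fun h4 => ?_, hA, ζ, hprim, hζ⟩
    have h := hζ 1
    rw [pow_one, pow_one, pow_one] at h
    have h' := congrArg (algebraMap F (AlgebraicClosure F)) h4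
    rw [map_pow, map_ofNat, h] at h'
    have hsq : ζ ^ 2 = 1 := by
      have : (ζ ^ 2 - 1) ^ 2 = 0 := by
        field_simp at h'
        linear_combination h'
      exact sub_eq_zero.mp (pow_eq_zero_iff two_ne_zero |>.mp this)
    have := Nat.le_of_dvd two_pos (hprim.dvd_of_pow_eq_one 2 hsq)
    have := hℓ.two_le
    obtain ⟨m, hm⟩ := hodd
    omega
  obtain ⟨A, rfl, hA4, hA, ζ, hζ, hAζ⟩ := key x hx
  obtain ⟨B, rfl, -, -, ξ, hξ, hBξ⟩ := key y hy
  have : NeZero ℓ := ⟨hℓ.ne_zero⟩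
  obtain ⟨k, -, hk⟩ := hξ.eq_pow_of_pow_eq_one hζ.pow_eq_one
  have ht : A.tr = (B ^ k).tr := by
    apply (algebraMap F (AlgebraicClosure F)).injective
    rw [hBξ, inv_pow, hk, ← pow_one A, hAζ, pow_one, pow_one]
  refine ⟨k, ?_⟩
  rw [← QuotientGroup.mk_pow]
  exact mk_isConj (isConj_of_tr_eq hA (fun hc => hA4 (ht ▸ tr_sq_of_mem_center hc)) ht (Or.inr hA4))

theorem exists_lift_of_orderOf_eq_char {p : ℕ} (hp : p.Prime) (hodd : Odd p) [CharP F p]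
    {x : PSL2 F} (hx : orderOf x = p) :
    ∃ A : SpecialLinearGroup (Fin 2) F, (A : PSL2 F) = x ∧ A.tr = 2 ∧
      A ∉ Subgroup.center (SpecialLinearGroup (Fin 2) F) := by
  have : Fact p.Prime := ⟨hp⟩
  obtain ⟨A, rfl, h1, hc⟩ := exists_lift_of_orderOf_odd hodd hx
  refine ⟨A, rfl, ?_, not_mem_center_of_orderOf hp.ne_one hx⟩
  obtain ⟨ζ, hζ0, hζ⟩ := exists_eigenvalue (AlgebraicClosure F) A
  have hpow := eigenvalue_pow_of_mem_center hζ0 hζ hc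
  rw [h1, map_one] at hpow
  have : CharP (AlgebraicClosure F) p := charP_of_injective_algebraMap' F p
  have h0 : (ζ - 1) ^ p = 0 := by
    rw [sub_pow_char, hpow, one_pow, sub_self]
  have hζ1 : ζ = 1 := sub_eq_zero.mp (pow_eq_zero_iff hp.ne_zero |>.mp h0)
  apply (algebraMap F (AlgebraicClosure F)).injective
  have := hζ 1
  rw [pow_one, hζ1] at this
  rw [this, map_ofNat]
  norm_num

theorem exists_nat_not_isSquare [Fintype F] {p e : ℕ} (hp : p.Prime) (hodd : Odd p) [CharP F p]
    (he : Odd e) (hF : Fintype.card F = p ^ e) : ∃ n : ℕ, ¬ IsSquare (n : F) := by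
  have : Fact p.Prime := ⟨hp⟩
  have hp2 : p ≠ 2 := by
    rintro rfl
    exact absurd hodd (by decide)
  obtain ⟨a, ha⟩ := FiniteField.exists_nonsquare (F := ZMod p) (by rwa [ZMod.ringChar_zmod_n])
  have ha0 : a ≠ 0 := by
    rintro rfl
    exact ha IsSquare.zero
  have hpow : a ^ (p / 2) = -1 :=
    (ZMod.pow_div_two_eq_neg_one_or_one p ha0).resolve_left
      fun h => ha ((ZMod.euler_criterion p ha0).mpr h)
  refine ⟨a.val, ?_⟩
  rintro ⟨b, hb⟩
  have hb0 : b ≠ 0 := by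
    rintro rfl
    apply ha0
    rw [mul_zero, CharP.cast_eq_zero_iff F p, ← CharP.cast_eq_zero_iff (ZMod p) p] at hb
    simpa using hb
  have h1 : ((a.val : ℕ) : F) ^ (p / 2) = -1 := by
    have h := congrArg (ZMod.castHom dvd_rfl F) hpow
    rw [map_pow, map_neg, map_one] at h
    rwa [← ZMod.natCast_zmod_val a, map_natCast] at h
  have h2 : b ^ p = -b := by
    obtain ⟨m, hm⟩ := hodd
    have : p / 2 = m := by omega
    rw [this, hb] at h1
    rw [hm, pow_succ, pow_mul, pow_two, h1]
    ring
  have h3 : ∀ n : ℕ, b ^ p ^ n = (-1) ^ n * b := by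
    intro n
    induction n with
    | zero => simp
    | succ n ih =>
      rw [pow_succ, pow_mul, ih, mul_pow, h2, ← pow_mul, mul_comm n p, pow_mul, hodd.neg_one_pow]
      ring
  have h4 := FiniteField.pow_card b
  rw [hF, h3, he.neg_one_pow] at h4
  have h5 : (2 : F) * b = 0 := by linear_combination -h4
  rcases mul_eq_zero.mp h5 with h | h
  · have : ((2 : ℕ) : F) = 0 := by exact_mod_cast h
    rw [CharP.cast_eq_zero_iff F p, Nat.prime_dvd_prime_iff_eq hp Nat.prime_two] at this
    exact hp2 this
  · exact hb0 h

theorem exists_isConj_pow_of_orderOf_eq_char [Fintype F] {p e : ℕ} (hp : p.Prime) (hodd : Odd p)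
    [CharP F p] (he : Odd e) (hF : Fintype.card F = p ^ e) {x y : PSL2 F} (hx : orderOf x = p)
    (hy : orderOf y = p) : ∃ j k : ℕ, x ^ j ≠ 1 ∧ IsConj (x ^ j) (y ^ k) := by
  obtain ⟨n, hn⟩ := exists_nat_not_isSquare hp hodd he hF
  have hchar : ringChar F ≠ 2 := by
    rw [ringChar.eq F p]
    rintro rfl
    exact absurd hodd (by decide)
  have key : ∀ z : PSL2 F, orderOf z = p → ∃ A : SpecialLinearGroup (Fin 2) F, ∃ k : ℕ,
      (A : PSL2 F) = z ^ k ∧ A.tr = 2 ∧ ∃ x y, A.cyclicForm x y = 1 := by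
    intro z hz
    obtain ⟨A, rfl, h2, hA⟩ := exists_lift_of_orderOf_eq_char hp hodd hz
    obtain ⟨x, y, hxy⟩ := exists_cyclicForm_ne_zero hA
    have hk : ∃ k : ℕ, IsSquare ((k : F) * A.cyclicForm x y) ∧ (k : F) ≠ 0 := by
      by_cases hs : IsSquare (A.cyclicForm x y)
      · exact ⟨1, by simpa using hs, by simp⟩
      · have hn0 : (n : F) ≠ 0 := by
          intro h
          exact hn (h ▸ IsSquare.zero)
        refine ⟨n, ?_, hn0⟩
        rw [FiniteField.isSquare_iff hchar (mul_ne_zero hn0 hxy), mul_pow]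
        rw [FiniteField.isSquare_iff hchar hn0] at hn
        rw [FiniteField.isSquare_iff hchar hxy] at hs
        rw [(FiniteField.pow_dichotomy hchar hn0).resolve_left hn,
          (FiniteField.pow_dichotomy hchar hxy).resolve_left hs]
        norm_num
    obtain ⟨k, ⟨m, hm⟩, hk0⟩ := hk
    have hm0 : m ≠ 0 := by
      rintro rfl
      simp [hk0, hxy] at hm
    refine ⟨A ^ k, k, QuotientGroup.mk_pow _ _ _, tr_pow_of_tr_eq_two h2 k, m⁻¹ * x, m⁻¹ * y, ?_⟩
    rw [cyclicForm_smul, cyclicForm_pow_of_tr_eq_two h2, hm]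
    field_simp
  obtain ⟨A, j, hAx, hA2, x', y', hA⟩ := key x hx
  obtain ⟨B, k, hBy, hB2, z, w, hB⟩ := key y hy
  have hA0 : A.cyclicForm x' y' ≠ 0 := by
    rw [hA]
    exact one_ne_zero
  refine ⟨j, k, ?_, ?_⟩
  · rw [← hAx, Ne, QuotientGroup.eq_one_iff]
    exact not_mem_center_of_cyclicForm_ne_zero hA0
  · rw [← hAx, ← hBy]
    exact mk_isConj (isConj_of_cyclicForm_eq (hA2.trans hB2.symm) hA0 (hA.trans hB.symm))

theorem eq_top_of_closure_eq_top {A B : SpecialLinearGroup (Fin 2) F}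
    (h : Subgroup.closure ({(A : PSL2 F), (B : PSL2 F)} : Set (PSL2 F)) = ⊤)
    {T : Subgroup (SpecialLinearGroup (Fin 2) F)}
    (hT : Subgroup.center (SpecialLinearGroup (Fin 2) F) ≤ T) (hA : A ∈ T) (hB : B ∈ T) :
    T = ⊤ := by
  have h1 : T.map (QuotientGroup.mk' (Subgroup.center (SpecialLinearGroup (Fin 2) F))) = ⊤ := by
    rw [eq_top_iff, ← h, Subgroup.closure_le]
    rintro z (rfl | rfl)
    · exact ⟨A, hA, rfl⟩
    · exact ⟨B, hB, rfl⟩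
  have h2 := congrArg
    (Subgroup.comap (QuotientGroup.mk' (Subgroup.center (SpecialLinearGroup (Fin 2) F)))) h1
  rwa [Subgroup.comap_map_eq, QuotientGroup.ker_mk', sup_eq_left.mpr hT, Subgroup.comap_top] at h2

/-- The stabilizer in `SL(2, F)` of the line spanned by `(x, y)`. -/
def lineStabilizer (x y : F) : Subgroup (SpecialLinearGroup (Fin 2) F) where
  carrier := {M | ∃ c, M 0 0 * x + M 0 1 * y = c * x ∧ M 1 0 * x + M 1 1 * y = c * y}
  one_mem' := ⟨1, by simp⟩
  mul_mem' := by
    rintro M N ⟨c, h1, h2⟩ ⟨d, h3, h4⟩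
    refine ⟨c * d, ?_, ?_⟩ <;> simp only [coe_mul, Matrix.mul_apply, Fin.sum_univ_two]
    · linear_combination M 0 0 * h3 + M 0 1 * h4 + d * h1
    · linear_combination M 1 0 * h3 + M 1 1 * h4 + d * h2
  inv_mem' := by
    rintro M ⟨c, h1, h2⟩
    refine ⟨M.tr - c, ?_, ?_⟩ <;> simp [Matrix.adjugate_fin_two, tr]
    · linear_combination -h1
    · linear_combination -h2

theorem lineStabilizer_ne_top {x y : F} (h : x ≠ 0 ∨ y ≠ 0) : lineStabilizer x y ≠ ⊤ := by
  intro htop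
  obtain ⟨U, hU⟩ : ∃ U : SpecialLinearGroup (Fin 2) F,
      (U : Matrix (Fin 2) (Fin 2) F) = !![1, 1; 0, 1] := ⟨⟨_, by simp⟩, rfl⟩
  obtain ⟨L, hL⟩ : ∃ L : SpecialLinearGroup (Fin 2) F,
      (L : Matrix (Fin 2) (Fin 2) F) = !![1, 0; 1, 1] := ⟨⟨_, by simp⟩, rfl⟩
  obtain ⟨c, h1, h2⟩ : U ∈ lineStabilizer x y := htop ▸ Subgroup.mem_top U
  obtain ⟨d, h3, h4⟩ : L ∈ lineStabilizer x y := htop ▸ Subgroup.mem_top L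
  simp [hU] at h1 h2
  simp [hL] at h3 h4
  have hy : y ^ 2 = 0 := by linear_combination y * h1 - x * h2
  have hx : x ^ 2 = 0 := by linear_combination x * h4 - y * h3
  rw [sq_eq_zero_iff] at hx hy
  exact h.elim (fun h => h hx) fun h => h hy

theorem center_le_lineStabilizer (x y : F) :
    Subgroup.center (SpecialLinearGroup (Fin 2) F) ≤ lineStabilizer x y := by
  intro M hM
  obtain ⟨h1, h2, h3⟩ := mem_center_fin_two.mp hM
  exact ⟨M 0 0, by simp [h1], by simp [h2, h3]⟩

theorem mem_lineStabilizer_of_cyclicForm_eq_zero {B : SpecialLinearGroup (Fin 2) F} {x y : F}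
    (hxy : x ≠ 0 ∨ y ≠ 0) (h : B.cyclicForm x y = 0) : B ∈ lineStabilizer x y := by
  rw [cyclicForm] at h
  rcases hxy with h0 | h0
  · refine ⟨(B 0 0 * x + B 0 1 * y) / x, ?_, ?_⟩ <;> field_simp
    linear_combination h
  · refine ⟨(B 1 0 * x + B 1 1 * y) / y, ?_, ?_⟩ <;> field_simp
    linear_combination -h

/-- The matrices that agree, up to a sign, with their image under the cube map twisted by
`τ`, in characteristic `3`. -/
def twistedCubeSubgroup (h3 : (3 : F) = 0) (τ : F) : Subgroup (SpecialLinearGroup (Fin 2) F) where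
  carrier := {M | ∃ ε : F, ε ^ 2 = 1 ∧ M 0 0 ^ 3 = ε * M 0 0 ∧ M 1 1 ^ 3 = ε * M 1 1 ∧
    M 0 1 ^ 3 * τ = ε * M 0 1 ∧ M 1 0 ^ 3 = ε * τ * M 1 0}
  one_mem' := ⟨1, by simp⟩
  mul_mem' := by
    rintro M N ⟨ε, h1, h2, h3', h4, h5⟩ ⟨ε', k1, k2, k3, k4, k5⟩
    have hcube : ∀ a b : F, (a + b) ^ 3 = a ^ 3 + b ^ 3 := by
      intro a b
      linear_combination (a ^ 2 * b + a * b ^ 2) * h3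
    refine ⟨ε * ε', ?_, ?_, ?_, ?_, ?_⟩ <;>
      simp only [coe_mul, Matrix.mul_apply, Fin.sum_univ_two, hcube, mul_pow]
    · rw [h1, k1, one_mul]
    · linear_combination N 0 0 ^ 3 * h2 + ε * M 0 0 * k2 + M 0 1 ^ 3 * k5 + ε' * N 1 0 * h4
    · linear_combination N 1 1 ^ 3 * h3' + ε * M 1 1 * k3 + N 0 1 ^ 3 * h5 + ε * M 1 0 * k4
    · linear_combination N 0 1 ^ 3 * τ * h2 + ε * M 0 0 * k4 + N 1 1 ^ 3 * h4 + ε * M 0 1 * k3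
    · linear_combination N 0 0 ^ 3 * h5 + ε * τ * M 1 0 * k2 + M 1 1 ^ 3 * k5 + ε' * τ * N 1 0 * h3'
  inv_mem' := by
    rintro M ⟨ε, h1, h2, h3, h4, h5⟩
    refine ⟨ε, h1, ?_, ?_, ?_, ?_⟩ <;> simp [Matrix.adjugate_fin_two]
    · exact h3
    · exact h2
    · linear_combination -h4
    · linear_combination -h5

theorem twistedCubeSubgroup_ne_top [Fintype F] (hF : Fintype.card F = 9) (h3 : (3 : F) = 0)
    (τ : F) : twistedCubeSubgroup h3 τ ≠ ⊤ := by
  intro htop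
  have key : ∀ ω : F, ω ^ 3 * τ = ω := by
    intro ω
    obtain ⟨U, hU⟩ : ∃ U : SpecialLinearGroup (Fin 2) F,
        (U : Matrix (Fin 2) (Fin 2) F) = !![1, ω; 0, 1] := ⟨⟨_, by simp⟩, rfl⟩
    obtain ⟨ε, -, h1, -, h2, -⟩ : U ∈ twistedCubeSubgroup h3 τ := htop ▸ Subgroup.mem_top U
    simp [hU] at h1 h2
    rw [h2, ← h1, one_mul]
  have hτ : τ = 1 := by simpa using key 1
  have h8 : ∀ x : Fˣ, x ^ 2 = 1 := by
    intro x
    have h := key x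
    ext
    rw [hτ, mul_one, pow_succ] at h
    push_cast
    exact mul_right_cancel₀ x.ne_zero (by rw [h, one_mul])
  have := (FiniteField.forall_pow_eq_one_iff F 2).mp h8
  rw [hF] at this
  revert this
  decide

theorem center_le_twistedCubeSubgroup (h3 : (3 : F) = 0) (τ : F) :
    Subgroup.center (SpecialLinearGroup (Fin 2) F) ≤ twistedCubeSubgroup h3 τ := by
  intro M hM
  obtain ⟨h1, h2, h⟩ := mem_center_fin_two.mp hM
  have hd := M.det_fin_two_eq_one
  rw [h1, h] at hd
  refine ⟨1, by simp, ?_, ?_, by simp [h1], by simp [h2]⟩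
  · rw [h]
    linear_combination M 1 1 * hd
  · linear_combination M 1 1 * hd

theorem exists_fixed_line {A : SpecialLinearGroup (Fin 2) F} (h : A.tr = 2) :
    ∃ x y k : F, (x ≠ 0 ∨ y ≠ 0) ∧ A 0 0 = 1 - k * x * y ∧ A 0 1 = k * x ^ 2 ∧
      A 1 0 = -(k * y ^ 2) ∧ A 1 1 = 1 + k * x * y := by
  have hd := A.det_fin_two_eq_one
  rw [tr] at h
  by_cases h01 : A 0 1 = 0
  · have h0 : (A 0 0 - 1) ^ 2 = 0 := by
      rw [h01] at hd
      linear_combination A 0 0 * h - hd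
    rw [sq_eq_zero_iff, sub_eq_zero] at h0
    refine ⟨0, 1, -A 1 0, by simp, by simp [h0], by simp [h01], by simp, ?_⟩
    rw [h0] at h
    linear_combination h
  · refine ⟨1, (1 - A 0 0) / A 0 1, A 0 1, by simp, ?_, ?_, ?_, ?_⟩ <;> field_simp
    · ring
    · linear_combination A 0 0 * h - hd
    · linear_combination h

/-- A unipotent `A` fixing `(x, y)` and a `B` not preserving this line lie in a conjugate of a
twisted cube subgroup as soon as `tr B` and `tr (A * B) = tr B + k * s` satisfy `t ^ 3 = ε * t`. -/
theorem not_closure_eq_top_of_tr_cube [Fintype F] (hF : Fintype.card F = 9) (h3 : (3 : F) = 0)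
    {A B : SpecialLinearGroup (Fin 2) F} {x y k s ε : F} (h00 : A 0 0 = 1 - k * x * y)
    (h01 : A 0 1 = k * x ^ 2) (h10 : A 1 0 = -(k * y ^ 2)) (h11 : A 1 1 = 1 + k * x * y)
    (hs : B.cyclicForm x y = s) (hs0 : s ≠ 0) (hε : ε ^ 2 = 1) (hB : B.tr ^ 3 = ε * B.tr)
    (hAB : (k * s) ^ 3 = ε * (k * s)) :
    Subgroup.closure ({(A : PSL2 F), (B : PSL2 F)} : Set (PSL2 F)) ≠ ⊤ := by
  intro hcl
  have hd := B.det_fin_two_eq_one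
  have hs' := hs
  rw [cyclicForm] at hs'
  obtain ⟨P, hP⟩ : ∃ P : SpecialLinearGroup (Fin 2) F, (P : Matrix (Fin 2) (Fin 2) F) =
      !![x, s⁻¹ * (B 0 0 * x + B 0 1 * y); y, s⁻¹ * (B 1 0 * x + B 1 1 * y)] := by
    refine ⟨⟨_, ?_⟩, rfl⟩
    rw [Matrix.det_fin_two_of]
    field_simp
    linear_combination hs'
  obtain ⟨A', hA'⟩ : ∃ A' : SpecialLinearGroup (Fin 2) F,
      (A' : Matrix (Fin 2) (Fin 2) F) = !![1, k; 0, 1] := ⟨⟨_, by simp⟩, rfl⟩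
  obtain ⟨B', hB'⟩ : ∃ B' : SpecialLinearGroup (Fin 2) F,
      (B' : Matrix (Fin 2) (Fin 2) F) = !![0, -s⁻¹; s, B.tr] :=
    ⟨⟨_, by simp [Matrix.det_fin_two, hs0]⟩, rfl⟩
  have hAP : A * P = P * A' := by
    ext i j
    rw [coe_mul, coe_mul, hP, hA']
    fin_cases i <;> fin_cases j <;>
      simp [Matrix.mul_apply, Fin.sum_univ_two, h00, h01, h10, h11] <;> field_simp
    · ring
    · linear_combination k * x * hs'
    · ring
    · linear_combination k * y * hs'
  have hBP : B * P = P * B' := by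
    ext i j
    rw [coe_mul, coe_mul, hP, hB']
    fin_cases i <;> fin_cases j <;> simp [Matrix.mul_apply, Fin.sum_univ_two, tr] <;> field_simp
    · linear_combination -x * hd
    · linear_combination -y * hd
  set f := (MulAut.conj P⁻¹).toMonoidHom with hf
  have hfA : ∀ {M N : SpecialLinearGroup (Fin 2) F}, M * P = P * N → f M = N := by
    intro M N h
    simp only [hf, MulEquiv.toMonoidHom_eq_coe, MonoidHom.coe_coe, MulAut.conj_apply, inv_inv]
    rw [mul_assoc, h, inv_mul_cancel_left]
  obtain ⟨τ, hτ⟩ : ∃ τ : F, τ = ε * s ^ 2 := ⟨_, rfl⟩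
  have htop := eq_top_of_closure_eq_top hcl (T := (twistedCubeSubgroup h3 τ).comap f) ?_ ?_ ?_
  · apply twistedCubeSubgroup_ne_top hF h3 τ
    apply Subgroup.comap_injective (f := f) (MulAut.conj P⁻¹).surjective
    rw [htop, Subgroup.comap_top]
  · intro M hM
    rw [Subgroup.mem_comap, hfA (Subgroup.mem_center_iff.mp hM P).symm]
    exact center_le_twistedCubeSubgroup h3 τ hM
  · rw [Subgroup.mem_comap, hfA hAP]
    refine ⟨1, by simp, ?_, ?_, ?_, ?_⟩ <;> simp [hA']
    apply mul_right_cancel₀ hs0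
    rw [hτ]
    linear_combination ε * hAB + k * s * hε
  · rw [Subgroup.mem_comap, hfA hBP]
    refine ⟨ε, hε, ?_, ?_, ?_, ?_⟩ <;> simp [hB', hτ]
    · exact hB
    · field_simp
    · linear_combination -s ^ 3 * hε

theorem not_closure_eq_top_of_not_isConj [Fintype F] (hF : Fintype.card F = 9) (h3 : (3 : F) = 0)
    {A B Y : SpecialLinearGroup (Fin 2) F} (hA2 : A.tr = 2)
    (hA : A ∉ Subgroup.center (SpecialLinearGroup (Fin 2) F)) (hY2 : Y.tr = 2)
    (hY : Y ∉ Subgroup.center (SpecialLinearGroup (Fin 2) F)) (hB5 : B.tr ^ 5 = B.tr)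
    (hAB5 : (A * B).tr ^ 5 = (A * B).tr) (hAY : ¬ IsConj (A : PSL2 F) Y)
    (hBY : ¬ IsConj (B : PSL2 F) Y)
    (hABY : ¬ IsConj ((A * B : SpecialLinearGroup (Fin 2) F) : PSL2 F) Y) :
    Subgroup.closure ({(A : PSL2 F), (B : PSL2 F)} : Set (PSL2 F)) ≠ ⊤ := by
  obtain ⟨x, y, k, hxy, h00, h01, h10, h11⟩ := exists_fixed_line hA2
  obtain ⟨s, hs⟩ : ∃ s, B.cyclicForm x y = s := ⟨_, rfl⟩
  by_cases hs0 : s = 0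
  · intro hcl
    refine lineStabilizer_ne_top hxy (eq_top_of_closure_eq_top hcl
      (center_le_lineStabilizer x y) ⟨1, ?_, ?_⟩
      (mem_lineStabilizer_of_cyclicForm_eq_zero hxy (hs.trans hs0)))
    · rw [h00, h01]
      ring
    · rw [h10, h11]
      ring
  have htAB : (A * B).tr = B.tr + k * s := by
    simp only [← hs, tr, cyclicForm, coe_mul, Matrix.mul_apply, Fin.sum_univ_two, h00, h01, h10,
      h11]
    ring
  have hsAB : (A * B).cyclicForm x y = s := by
    simp only [← hs, cyclicForm, coe_mul, Matrix.mul_apply, Fin.sum_univ_two, h00, h01, h10,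
      h11]
    ring
  have hk0 : k ≠ 0 := by
    rintro rfl
    exact hA (mem_center_fin_two.mpr (by simp [h00, h01, h10, h11]))
  have hAw : A.cyclicForm (B 0 0 * x + B 0 1 * y) (B 1 0 * x + B 1 1 * y) = -(k * s ^ 2) := by
    simp only [← hs, cyclicForm, h00, h01, h10, h11]
    ring
  have hroot : ∀ t : F, t ^ 5 = t → t = 0 ∨ t ^ 2 = 1 ∨ t ^ 2 = -1 := by
    intro t ht
    have : t * ((t ^ 2 - 1) * (t ^ 2 + 1)) = 0 := by linear_combination ht
    rcases mul_eq_zero.mp this with h | h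
    · exact Or.inl h
    · rcases mul_eq_zero.mp h with h | h
      · exact Or.inr (Or.inl (sub_eq_zero.mp h))
      · exact Or.inr (Or.inr (eq_neg_of_add_eq_zero_left h))
  have hpow4 : ∀ a : F, a ≠ 0 → a ^ 4 = 1 ∨ a ^ 4 = -1 := by
    intro a ha
    have h := FiniteField.pow_card_sub_one_eq_one a ha
    rw [hF] at h
    have : (a ^ 4) ^ 2 = 1 := by rw [← pow_mul]; exact h
    exact mul_self_eq_one_iff.mp ((pow_two _).symm.trans this)
  have hchar : ringChar F ≠ 2 := by
    intro h
    have h2 := ringChar.Nat.cast_ringChar (R := F)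
    rw [h] at h2
    push_cast at h2
    exact one_ne_zero (α := F) (by linear_combination h3 - h2)
  have hsquare : ∀ a : F, a ≠ 0 → a ^ 4 = 1 → ∃ m, a = m * m := by
    intro a ha h
    exact (FiniteField.isSquare_iff hchar ha).mpr (by rw [hF]; exact h)
  have hcross : ∀ D : SpecialLinearGroup (Fin 2) F, D.cyclicForm x y = s → D.tr ^ 2 = 1 →
      ¬ IsConj (D : PSL2 F) Y → (k * s) ^ 4 ≠ -1 := by
    intro D hDs hDt hDY hks
    obtain ⟨D', s', hD', hs', hs4, ht'⟩ : ∃ (D' : SpecialLinearGroup (Fin 2) F) (s' : F),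
        (D' : PSL2 F) = D ∧ D'.cyclicForm x y = s' ∧ s' ^ 4 = s ^ 4 ∧ D'.tr = 2 := by
      rcases mul_self_eq_one_iff.mp ((pow_two _).symm.trans hDt) with h | h
      · refine ⟨-D, -s, mk_neg D, by rw [cyclicForm_neg, hDs], by ring, ?_⟩
        rw [tr_neg, h]
        linear_combination -h3
      · refine ⟨D, s, rfl, hDs, rfl, ?_⟩
        rw [h]
        linear_combination -h3
    obtain ⟨z, w, hzw⟩ := exists_cyclicForm_ne_zero hY
    obtain ⟨u, hu⟩ : ∃ u, Y.cyclicForm z w = u := ⟨_, rfl⟩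
    rw [hu] at hzw
    have hs'0 : s' ≠ 0 := by
      rintro rfl
      exact hs0 (pow_eq_zero_iff four_ne_zero |>.mp (by rw [← hs4]; simp))
    rcases hpow4 (-(k * u)) (neg_ne_zero.mpr (mul_ne_zero hk0 hzw)) with h | h
    · obtain ⟨m, hm⟩ := hsquare _ (neg_ne_zero.mpr (mul_ne_zero hk0 hzw)) h
      apply hAY
      have hval : A.cyclicForm (m / (k * s) * (B 0 0 * x + B 0 1 * y))
          (m / (k * s) * (B 1 0 * x + B 1 1 * y)) = u := by
        rw [cyclicForm_smul, hAw]
        field_simp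
        linear_combination hm
      exact mk_isConj (isConj_of_cyclicForm_eq (hA2.trans hY2.symm) (by rwa [hval])
        (hval.trans hu.symm))
    · have hsu : (s' * u) ^ 4 = 1 := by
        have hk8 : (k ^ 4) ^ 2 = 1 := by rcases hpow4 k hk0 with hk | hk <;> simp [hk]
        linear_combination u ^ 4 * hs4 - s ^ 4 * u ^ 4 * hk8 + k ^ 4 * u ^ 4 * hks - h
      obtain ⟨m, hm⟩ := hsquare _ (mul_ne_zero hs'0 hzw) hsu
      apply hDY
      have hval : D'.cyclicForm (m / s' * x) (m / s' * y) = u := by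
        rw [cyclicForm_smul, hs']
        field_simp
        linear_combination -hm
      rw [← hD']
      exact mk_isConj (isConj_of_cyclicForm_eq (ht'.trans hY2.symm) (by rwa [hval])
        (hval.trans hu.symm))
  have hcase : ∃ ε : F, ε ^ 2 = 1 ∧ B.tr ^ 3 = ε * B.tr ∧ (A * B).tr ^ 3 = ε * (A * B).tr := by
    rcases hroot _ hB5 with h | h | h <;> rcases hroot _ hAB5 with h' | h' | h'
    · exact ⟨1, by simp, by simp [h], by simp [h']⟩
    · exact ⟨1, by simp, by simp [h], by rw [pow_succ, h']⟩
    · exact ⟨-1, by simp, by simp [h], by rw [pow_succ, h']⟩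
    · exact ⟨1, by simp, by rw [pow_succ, h], by simp [h']⟩
    · exact ⟨1, by simp, by rw [pow_succ, h], by rw [pow_succ, h']⟩
    · refine absurd ?_ (hcross B hs h hBY)
      have hks : (k * s) ^ 2 = B.tr * (A * B).tr := by
        rw [htAB] at h' ⊢
        linear_combination h + h' - (B.tr ^ 2 + B.tr * (k * s)) * h3
      linear_combination ((k * s) ^ 2 + B.tr * (A * B).tr) * hks + (A * B).tr ^ 2 * h + h'
    · exact ⟨-1, by simp, by rw [pow_succ, h], by simp [h']⟩
    · refine absurd ?_ (hcross (A * B) hsAB h' hABY)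
      have hks : (k * s) ^ 2 = B.tr * (A * B).tr := by
        rw [htAB] at h' ⊢
        linear_combination h + h' - (B.tr ^ 2 + B.tr * (k * s)) * h3
      linear_combination ((k * s) ^ 2 + B.tr * (A * B).tr) * hks + (A * B).tr ^ 2 * h - h'
    · exact ⟨-1, by simp, by rw [pow_succ, h], by rw [pow_succ, h']⟩
  obtain ⟨ε, hε, hB3, hAB3⟩ := hcase
  refine not_closure_eq_top_of_tr_cube hF h3 h00 h01 h10 h11 hs hs0 hε hB3 ?_
  rw [htAB] at hAB3
  linear_combination hAB3 - hB3 - (B.tr ^ 2 * (k * s) + B.tr * (k * s) ^ 2) * h3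

theorem pow_add_two_apply (A : SpecialLinearGroup (Fin 2) F) (n : ℕ) (i j : Fin 2) :
    (A ^ (n + 2)) i j = A.tr * (A ^ (n + 1)) i j - (A ^ n) i j := by
  have hd := A.det_fin_two_eq_one
  have h1 : A ^ (n + 1) = A * A ^ n := pow_succ' A n
  have h2 : A ^ (n + 2) = A * (A * A ^ n) := by rw [← h1, ← pow_succ']
  rw [h1, h2, tr]
  fin_cases i <;> simp only [coe_mul, Matrix.mul_apply, Fin.sum_univ_two, Fin.zero_eta, Fin.mk_one]
  · linear_combination -(A ^ n) 0 j * hd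
  · linear_combination -(A ^ n) 1 j * hd

theorem tr_pow_five_of_not_dvd [Fintype F] (hF : Fintype.card F = 9) (h3 : (3 : F) = 0)
    {A : SpecialLinearGroup (Fin 2) F} (h : ¬ 5 ∣ orderOf (A : PSL2 F)) : A.tr ^ 5 = A.tr := by
  contrapose! h
  have h8 := FiniteField.pow_card A.tr
  rw [hF] at h8
  have h4 : A.tr ^ 4 = -1 := by
    have : (A.tr ^ 5 - A.tr) * (A.tr ^ 4 + 1) = 0 := by linear_combination h8
    exact eq_neg_of_add_eq_zero_left ((mul_eq_zero.mp this).resolve_left (sub_ne_zero.mpr h))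
  have h5 : A ^ 5 ∈ Subgroup.center (SpecialLinearGroup (Fin 2) F) := by
    refine mem_center_fin_two.mpr ⟨?_, ?_, ?_⟩ <;>
      simp only [pow_add_two_apply A 3, pow_add_two_apply A 2, pow_add_two_apply A 1,
        pow_add_two_apply A 0, zero_add, pow_one, pow_zero, coe_one, Matrix.one_apply_eq,
        Matrix.one_apply_ne zero_ne_one, Matrix.one_apply_ne one_ne_zero]
    · linear_combination A 0 1 * h4 - A.tr ^ 2 * A 0 1 * h3
    · linear_combination A 1 0 * h4 - A.tr ^ 2 * A 1 0 * h3
    · linear_combination (A 0 0 - A 1 1) * (h4 - A.tr ^ 2 * h3)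
  have hne : (A : PSL2 F) ≠ 1 := by
    rw [Ne, QuotientGroup.eq_one_iff]
    intro hc
    have := tr_sq_of_mem_center hc
    have h1 : (1 : F) = 0 := by
      linear_combination 6 * h3 - h4 + (A.tr ^ 2 + 4) * this
    exact one_ne_zero h1
  have : Fact (Nat.Prime 5) := ⟨by norm_num⟩
  exact (orderOf_eq_prime (mk_pow_eq_one_iff.mpr h5) hne).symm.dvd

theorem exists_lift_of_three_dvd (h3 : (3 : F) = 0) {A : SpecialLinearGroup (Fin 2) F}
    (h5 : A.tr ^ 5 = A.tr) (h : 3 ∣ orderOf (A : PSL2 F)) :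
    ∃ A' : SpecialLinearGroup (Fin 2) F, (A' : PSL2 F) = A ∧ A'.tr = 2 ∧
      A' ∉ Subgroup.center (SpecialLinearGroup (Fin 2) F) := by
  have hA : A ∉ Subgroup.center (SpecialLinearGroup (Fin 2) F) := by
    rw [← QuotientGroup.eq_one_iff]
    intro h1
    rw [h1, orderOf_one] at h
    omega
  have h4 : A ^ 4 ∉ Subgroup.center (SpecialLinearGroup (Fin 2) F) := by
    rw [← mk_pow_eq_one_iff, ← orderOf_dvd_iff_pow_eq_one]
    intro h4
    exact absurd (h.trans h4) (by decide)
  have ht : A.tr = 1 ∨ A.tr = -1 := by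
    by_contra hne
    push Not at hne
    have h0 : A.tr * (A.tr ^ 2 + 1) = 0 := by
      have : (A.tr - 1) * ((A.tr + 1) * (A.tr * (A.tr ^ 2 + 1))) = 0 := by linear_combination h5
      have := (mul_eq_zero.mp this).resolve_left (sub_ne_zero.mpr hne.1)
      exact (mul_eq_zero.mp this).resolve_left fun h => hne.2 (eq_neg_of_add_eq_zero_left h)
    refine h4 (mem_center_fin_two.mpr ⟨?_, ?_, ?_⟩) <;>
      simp only [pow_add_two_apply A 2, pow_add_two_apply A 1,
        pow_add_two_apply A 0, zero_add, pow_one, pow_zero, coe_one, Matrix.one_apply_eq,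
        Matrix.one_apply_ne zero_ne_one, Matrix.one_apply_ne one_ne_zero]
    · linear_combination A 0 1 * h0 - A.tr * A 0 1 * h3
    · linear_combination A 1 0 * h0 - A.tr * A 1 0 * h3
    · linear_combination (A 0 0 - A 1 1) * (h0 - A.tr * h3)
  rcases ht with ht | ht
  · refine ⟨-A, mk_neg A, ?_, by rwa [neg_mem_center_iff]⟩
    rw [tr_neg, ht]
    linear_combination -h3
  · refine ⟨A, rfl, ?_, hA⟩
    rw [ht]
    linear_combination -h3

theorem charP_three_of_card_eq_nine [Fintype F] (hF : Fintype.card F = 9) : CharP F 3 := by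
  obtain ⟨p, hp⟩ := CharP.exists F
  obtain ⟨n, hprime, hn⟩ := FiniteField.card F p
  have : p ∣ 3 := hprime.dvd_of_dvd_pow (n := 2) (by
    rw [show 3 ^ 2 = p ^ (n : ℕ) by rw [← hn, hF]; norm_num]
    exact dvd_pow_self p n.ne_zero)
  rwa [(Nat.prime_dvd_prime_iff_eq hprime Nat.prime_three).mp this] at hp

/-- In `PSL₂(9)` a generating triple without elements of order `5`, whose first member has order
divisible by `3`, meets every conjugacy class of elements of order `3`. -/
theorem exists_isConj_pow_of_card_eq_nine [Fintype F] (hF : Fintype.card F = 9) {a b c y : PSL2 F}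
    (habc : a * b * c = 1) (hcl : Subgroup.closure ({a, b} : Set (PSL2 F)) = ⊤)
    (h5b : ¬ 5 ∣ orderOf b) (h5c : ¬ 5 ∣ orderOf c) (h5a : ¬ 5 ∣ orderOf a)
    (h3a : 3 ∣ orderOf a) (hy : orderOf y = 3) :
    ∃ z, (z = a ∨ z = b ∨ z = c) ∧ ∃ k : ℕ, IsConj (z ^ k) y := by
  by_contra! hno
  have := charP_three_of_card_eq_nine hF
  have h3 : (3 : F) = 0 := by exact_mod_cast CharP.cast_eq_zero F 3
  obtain ⟨A, rfl⟩ := QuotientGroup.mk_surjective a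
  obtain ⟨B, rfl⟩ := QuotientGroup.mk_surjective b
  obtain ⟨A', hA', hA2, hA⟩ := exists_lift_of_three_dvd h3 (tr_pow_five_of_not_dvd hF h3 h5a) h3a
  obtain ⟨Y, rfl, hY2, hY⟩ := exists_lift_of_orderOf_eq_char Nat.prime_three (by decide) hy
  rw [← hA'] at habc hcl
  have hc : c = ((A' * B : SpecialLinearGroup (Fin 2) F) : PSL2 F)⁻¹ :=
    eq_inv_of_mul_eq_one_right habc
  refine not_closure_eq_top_of_not_isConj hF h3 hA2 hA hY2 hY (tr_pow_five_of_not_dvd hF h3 h5b)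
    (tr_pow_five_of_not_dvd hF h3 ?_) ?_ ?_ ?_ hcl
  · rwa [hc, orderOf_inv] at h5c
  · simpa [hA'] using hno _ (Or.inl rfl) 1
  · simpa using hno _ (Or.inr (Or.inl rfl)) 1
  · have h := hno c (Or.inr (Or.inr rfl)) (orderOf c - 1)
    rwa [show c ^ (orderOf c - 1) = c⁻¹ by
      rw [eq_inv_iff_mul_eq_one, ← pow_succ, Nat.sub_add_cancel (orderOf_pos c),
        pow_orderOf_eq_one], hc, inv_inv] at h

theorem closure_rotate {G : Type*} [Group G] {a b c : G} (h : a * b * c = 1)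
    (hcl : Subgroup.closure ({a, b} : Set G) = ⊤) : Subgroup.closure ({b, c} : Set G) = ⊤ := by
  rw [eq_top_iff, ← hcl, Subgroup.closure_le]
  have hb : b ∈ Subgroup.closure ({b, c} : Set G) := Subgroup.subset_closure (by simp)
  have hc : c ∈ Subgroup.closure ({b, c} : Set G) := Subgroup.subset_closure (by simp)
  have ha : a = (b * c)⁻¹ := eq_inv_of_mul_eq_one_left (by rw [← mul_assoc, h])
  rintro z (rfl | rfl)
  · rw [ha]
    exact inv_mem (mul_mem hb hc)
  · exact hb

theorem mul_rotate_eq_one {G : Type*} [Group G] {a b c : G} (h : a * b * c = 1) :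
    b * c * a = 1 := by
  rw [eq_inv_of_mul_eq_one_left ((mul_assoc a b c).symm.trans h), mul_inv_cancel]

theorem exists_isConj_pow_of_three_dvd_orderOf [Fintype F] (hF : Fintype.card F = 9)
    {a b c x y : PSL2 F}
    (habc : a * b * c = 1) (hcl : Subgroup.closure ({a, b} : Set (PSL2 F)) = ⊤)
    (h5 : ∀ z, (z = a ∨ z = b ∨ z = c) → ¬ 5 ∣ orderOf z) (hx : x = a ∨ x = b ∨ x = c)
    (h3 : 3 ∣ orderOf x) (hy : orderOf y = 3) :
    ∃ z, (z = a ∨ z = b ∨ z = c) ∧ ∃ k : ℕ, IsConj (z ^ k) y := by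
  have ha := h5 a (by simp)
  have hb := h5 b (by simp)
  have hc := h5 c (by simp)
  have habc' := mul_rotate_eq_one habc
  have hcl' := closure_rotate habc hcl
  rcases hx with rfl | rfl | rfl
  · exact exists_isConj_pow_of_card_eq_nine hF habc hcl hb hc ha h3 hy
  · obtain ⟨z, hz, h⟩ := exists_isConj_pow_of_card_eq_nine hF habc' hcl' hc ha hb h3 hy
    exact ⟨z, by tauto, h⟩
  · obtain ⟨z, hz, h⟩ := exists_isConj_pow_of_card_eq_nine hF (mul_rotate_eq_one habc')
      (closure_rotate habc' hcl') ha hb hc h3 hy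
    exact ⟨z, by tauto, h⟩

end PSL2

theorem IsUnmixedBeauville.eq_one_of_isConj {G : Type*} [Group G] {a₁ b₁ c₁ a₂ b₂ c₂ x y : G}
    (h : IsUnmixedBeauville a₁ b₁ c₁ a₂ b₂ c₂) (hx : x = a₁ ∨ x = b₁ ∨ x = c₁)
    (hy : y = a₂ ∨ y = b₂ ∨ y = c₂) {j k : ℕ} (hxy : IsConj (x ^ j) (y ^ k)) : x ^ j = 1 := by
  obtain ⟨-, -, -, -, h⟩ := h
  have hpow : ∀ {a b c z : G}, (z = a ∨ z = b ∨ z = c) →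
      ∀ w, w ∈ conjPowers z → w ∈ sigma3 a b c := by
    rintro a b c z (rfl | rfl | rfl) w hw
    · exact Or.inl (Or.inl hw)
    · exact Or.inl (Or.inr hw)
    · exact Or.inr hw
  obtain ⟨g, hg⟩ := isConj_iff.mp hxy.symm
  have : x ^ j ∈ sigma3 a₁ b₁ c₁ ∩ sigma3 a₂ b₂ c₂ :=
    ⟨hpow hx _ ⟨1, j, by simp⟩, hpow hy _ ⟨g, k, hg.symm⟩⟩
  rw [h] at this
  exact this

theorem IsUnmixedBeauville.symm {G : Type*} [Group G] {a₁ b₁ c₁ a₂ b₂ c₂ : G}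
    (h : IsUnmixedBeauville a₁ b₁ c₁ a₂ b₂ c₂) : IsUnmixedBeauville a₂ b₂ c₂ a₁ b₁ c₁ := by
  obtain ⟨h1, h2, h3, h4, h5⟩ := h
  exact ⟨h2, h1, h4, h3, by rwa [Set.inter_comm]⟩

namespace PSL2

variable {F : Type*} [Field F]

theorem not_dvd_orderOf_of_isUnmixedBeauville [Fintype F] {ℓ : ℕ} (hℓ : ℓ.Prime)
    (hF : ℓ = 2 ∨ (ℓ : F) ≠ 0 ∨ ∃ e, Odd e ∧ Fintype.card F = ℓ ^ e)
    {a₁ b₁ c₁ a₂ b₂ c₂ x y : PSL2 F}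
    (h : IsUnmixedBeauville a₁ b₁ c₁ a₂ b₂ c₂) (hx : x = a₁ ∨ x = b₁ ∨ x = c₁)
    (hy : y = a₂ ∨ y = b₂ ∨ y = c₂) (hxℓ : ℓ ∣ orderOf x) : ¬ ℓ ∣ orderOf y := by
  intro hyℓ
  have hx' := orderOf_pow_orderOf_div (orderOf_pos x).ne' hxℓ
  have hy' := orderOf_pow_orderOf_div (orderOf_pos y).ne' hyℓ
  have key : ∃ j k : ℕ, (x ^ (orderOf x / ℓ)) ^ j ≠ 1 ∧
      IsConj ((x ^ (orderOf x / ℓ)) ^ j) ((y ^ (orderOf y / ℓ)) ^ k) := by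
    have hne : x ^ (orderOf x / ℓ) ≠ 1 := by
      intro h1
      rw [h1, orderOf_one] at hx'
      exact hℓ.ne_one hx'.symm
    by_cases h2 : ℓ = 2
    · subst h2
      exact ⟨1, 1, by rwa [pow_one], by simpa using isConj_of_orderOf_eq_two hx' hy'⟩
    · have hodd := hℓ.odd_of_ne_two h2
      by_cases h0 : (ℓ : F) = 0
      · obtain ⟨e, he, hcard⟩ := (hF.resolve_left h2).resolve_left (not_not.mpr h0)
        have : CharP F ℓ := by
          rw [← CharP.ringChar_of_prime_eq_zero hℓ h0]
          exact ringChar.charP F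
        exact exists_isConj_pow_of_orderOf_eq_char hℓ hodd he hcard hx' hy'
      · obtain ⟨k, hk⟩ := exists_isConj_pow_of_orderOf_eq hℓ hodd h0 hx' hy'
        exact ⟨1, k, by rwa [pow_one], by rwa [pow_one]⟩
  obtain ⟨j, k, hne, hconj⟩ := key
  simp only [← pow_mul] at hne hconj
  exact hne (h.eq_one_of_isConj hx hy hconj)

theorem not_three_dvd_orderOf_of_card_eq_nine [Fintype F] (hF : Fintype.card F = 9)
    {a₁ b₁ c₁ a₂ b₂ c₂ x y : PSL2 F}
    (h : IsUnmixedBeauville a₁ b₁ c₁ a₂ b₂ c₂) (hx : x = a₁ ∨ x = b₁ ∨ x = c₁)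
    (hy : y = a₂ ∨ y = b₂ ∨ y = c₂) (hx3 : 3 ∣ orderOf x) : ¬ 3 ∣ orderOf y := by
  have := charP_three_of_card_eq_nine hF
  have h5 : ((5 : ℕ) : F) ≠ 0 := by
    rw [Ne, CharP.cast_eq_zero_iff F 3]
    decide
  have key : ∀ {a₁ b₁ c₁ a₂ b₂ c₂ x y : PSL2 F}, IsUnmixedBeauville a₁ b₁ c₁ a₂ b₂ c₂ →
      (x = a₁ ∨ x = b₁ ∨ x = c₁) → (y = a₂ ∨ y = b₂ ∨ y = c₂) →
      (∀ z, (z = a₁ ∨ z = b₁ ∨ z = c₁) → ¬ 5 ∣ orderOf z) → 3 ∣ orderOf x →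
      ¬ 3 ∣ orderOf y := by
    intro a₁ b₁ c₁ a₂ b₂ c₂ x y h hx hy hz hx3 hy3
    have hy' := orderOf_pow_orderOf_div (orderOf_pos y).ne' hy3
    obtain ⟨z, hz, k, hk⟩ := exists_isConj_pow_of_three_dvd_orderOf hF h.1 h.2.2.1 hz hx hx3 hy'
    rw [h.symm.eq_one_of_isConj hy hz hk.symm, orderOf_one] at hy'
    omega
  intro hy3
  by_cases hz : ∀ z, (z = a₁ ∨ z = b₁ ∨ z = c₁) → ¬ 5 ∣ orderOf z
  · exact key h hx hy hz hx3 hy3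
  · push Not at hz
    obtain ⟨z, hz, hz5⟩ := hz
    exact key h.symm hy hx (fun w hw => not_dvd_orderOf_of_isUnmixedBeauville
      (by norm_num) (Or.inr (Or.inl h5)) h hz hw hz5) hy3 hx3

end PSL2

/-- Let `G = PSL₂(q)` with `5 < q = p ^ e`, where `p = 2`, or `e` is odd,
or `q = 9`.  If `G` admits an unmixed Beauville structure of type
`((r₁,s₁,t₁),(r₂,s₂,t₂))`, then `r₁ s₁ t₁` is coprime to `r₂ s₂ t₂`. -/
theorem coprime_of_beauville_type_PSL2 (p e : ℕ) (hp : p.Prime) (he : 0 < e)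
    (hq : 5 < p ^ e) (hcase : p = 2 ∨ Odd e ∨ p ^ e = 9)
    (F : Type*) [Field F] [Fintype F] (hF : Fintype.card F = p ^ e)
    (r₁ s₁ t₁ r₂ s₂ t₂ : ℕ)
    (h : HasBeauvilleOfType (PSL2 F) r₁ s₁ t₁ r₂ s₂ t₂) :
    Nat.Coprime (r₁ * s₁ * t₁) (r₂ * s₂ * t₂) := by
  obtain ⟨a₁, b₁, c₁, a₂, b₂, c₂, hB, rfl, rfl, rfl, rfl, rfl, rfl⟩ := h
  refine Nat.Coprime.symm (Nat.coprime_of_dvd fun ℓ hℓ h₂ h₁ => ?_)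
  have hdvd : ∀ {a b c : PSL2 F}, ℓ ∣ orderOf a * orderOf b * orderOf c →
      ∃ x, (x = a ∨ x = b ∨ x = c) ∧ ℓ ∣ orderOf x := by
    intro a b c h
    rcases hℓ.dvd_mul.mp h with h | h
    · rcases hℓ.dvd_mul.mp h with h | h
      · exact ⟨a, by simp, h⟩
      · exact ⟨b, by simp, h⟩
    · exact ⟨c, by simp, h⟩
  obtain ⟨x, hx, hxℓ⟩ := hdvd h₁
  obtain ⟨y, hy, hyℓ⟩ := hdvd h₂
  have hcard : Fintype.card F = 9 ∧ ℓ = 3 ∨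
      (ℓ = 2 ∨ (ℓ : F) ≠ 0 ∨ ∃ e, Odd e ∧ Fintype.card F = ℓ ^ e) := by
    by_cases h0 : (ℓ : F) = 0
    · have hℓp : ℓ = p := by
        have hdvd : ringChar F ∣ Fintype.card F :=
          ringChar.dvd (Nat.cast_card_eq_zero F)
        rw [CharP.ringChar_of_prime_eq_zero hℓ h0, hF] at hdvd
        exact (Nat.prime_dvd_prime_iff_eq hℓ hp).mp (hℓ.dvd_of_dvd_pow hdvd)
      subst hℓp
      rcases hcase with h | h | h
      · exact Or.inr (Or.inl h)
      · exact Or.inr (Or.inr (Or.inr ⟨e, h, hF⟩))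
      · refine Or.inl ⟨hF.trans h, ?_⟩
        have : ℓ ∣ 3 ^ 2 := by
          rw [show 3 ^ 2 = 9 by rfl, ← h]
          exact dvd_pow_self ℓ he.ne'
        exact (Nat.prime_dvd_prime_iff_eq hℓ Nat.prime_three).mp (hℓ.dvd_of_dvd_pow this)
    · exact Or.inr (Or.inr (Or.inl h0))
  rcases hcard with ⟨h9, rfl⟩ | hcard
  · exact PSL2.not_three_dvd_orderOf_of_card_eq_nine h9 hB hx hy hxℓ hyℓ
  · exact PSL2.not_dvd_orderOf_of_isUnmixedBeauville hℓ hcard hB hx hy hxℓ hyℓ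
end
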